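/- arXiv:math/9807029 — 5 statements merged into one kernel-verified Lean document; each statement's English description precedes it below -/
import Mathlib

section
/- Let d ≥ 2, let q = 2^d, and let k ≥ 2 be an integer with gcd(k, q−1) = 1. Suppose the map τ : F_q → F_q defined by τ(x) = x + x^k is two-to-one, i.e., every element of the image τ(F_q) has exactly two preimages under τ. Then D_{k,d} := τ(F_q) \ {0} is a (q−1, q/2−1, q/4−1) difference set in the multiplicative group F_q^*. -/
/-- `D` is a `(v,K,λ)` difference set in the group `G`: `G` has order `v`, `D` has `K`
elements, and every nonidentity `g ∈ G` can be written as `d₁ * d₂⁻¹` with `d₁, d₂ ∈ D`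
in exactly `lam` ways. -/
def IsDiffSet {G : Type*} [Group G] (v K lam : ℕ) (D : Set G) : Prop :=
  Nat.card G = v ∧ Nat.card D = K ∧
  ∀ g : G, g ≠ 1 →
    Nat.card {p : G × G // p.1 ∈ D ∧ p.2 ∈ D ∧ p.1 * p.2⁻¹ = g} = lam

section Helpers
open Finset

variable {F : Type*} [Field F] [Fintype F] [DecidableEq F]

/-- Injectivity of the `n`-th power map from triviality of the `n`-torsion. -/
lemma pow_bij_of_torsion (n : ℕ) (hn : n ≠ 0) (h : ∀ a : F, a ^ n = 1 → a = 1) :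
    Function.Bijective (fun x : F => x ^ n) := by
  refine Finite.injective_iff_bijective.mp ?_
  intro a b hab
  simp only at hab
  by_cases hb : b = 0
  · subst hb
    rw [zero_pow hn] at hab
    exact pow_eq_zero_iff hn |>.mp hab
  · have : a / b = 1 := h _ (by rw [div_pow, hab, div_self (pow_ne_zero _ hb)])
    rwa [div_eq_one_iff_eq hb] at this

/-- Solutions with nonzero second coordinate. -/
lemma card_sol_ne [CharP F 2] (k : ℕ) (hk : 2 ≤ k)
    (h1 : Function.Bijective (fun x : F => x ^ k))
    (h2 : Function.Bijective (fun x : F => x ^ (k - 1))) (g : F) (g0 : g ≠ 0) (g1 : g ≠ 1) :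
    (univ.filter (fun p : F × F => p.1 + p.1 ^ k = g * (p.2 + p.2 ^ k) ∧ p.2 ≠ 0)).card + 2
      = Fintype.card F := by
  obtain ⟨h, hh⟩ := h1.2 g
  simp only at hh
  have hgk : g ^ k ≠ g := by
    intro e
    have e2 : g ^ (k - 1) = 1 ^ (k - 1) := by
      have : g ^ (k - 1) * g = 1 * g := by
        rw [← pow_succ, Nat.sub_add_cancel (by omega), e, one_mul]
      rw [one_pow]; exact mul_right_cancel₀ g0 this
    exact g1 (h2.1 e2)
  have hne : h ≠ g := by
    rintro rfl; exact hgk hh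
  have hT : (univ \ {g, h} : Finset F).card + 2 = Fintype.card F := by
    rw [← card_pair hne.symm, card_sdiff_add_card_eq_card (subset_univ _), card_univ]
  rw [← hT]
  congr 1
  have key : ∀ t y : F, (t * y) + (t * y) ^ k + g * (y + y ^ k) =
      y * ((t + g) + y ^ (k - 1) * (t ^ k + g)) := by
    intro t y
    have : y ^ k = y * y ^ (k - 1) := by rw [← pow_succ', Nat.sub_add_cancel (by omega)]
    rw [mul_pow, this]; ring
  have hsol : ∀ t y : F, y ≠ 0 → ((t * y) + (t * y) ^ k = g * (y + y ^ k) ↔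
      t + g = y ^ (k - 1) * (t ^ k + g)) := by
    intro t y hy
    rw [← CharTwo.add_eq_zero, key, mul_eq_zero, or_iff_right hy, CharTwo.add_eq_zero]
  have hA : ∀ t y : F, y ≠ 0 → t + g = y ^ (k - 1) * (t ^ k + g) →
      t ≠ g ∧ t ^ k ≠ g := by
    intro t y hy e
    have hy' := pow_ne_zero (k - 1) hy
    constructor
    · rintro rfl
      rw [CharTwo.add_self_eq_zero] at e
      have := (mul_eq_zero.mp e.symm).resolve_left hy'
      exact hgk (CharTwo.add_eq_zero.mp this)
    · intro e2
      rw [e2, CharTwo.add_self_eq_zero, mul_zero, CharTwo.add_eq_zero] at e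
      exact hgk (e ▸ e2)
  refine card_bij (fun p _ => p.1 / p.2) ?_ ?_ ?_
  · rintro ⟨x, y⟩ hp
    simp only [mem_filter, mem_univ, true_and] at hp
    obtain ⟨hp, hy⟩ := hp
    have hx : x = (x / y) * y := by field_simp
    rw [hx, hsol _ _ hy] at hp
    obtain ⟨a, b⟩ := hA _ _ hy hp
    simp only [mem_sdiff, mem_univ, true_and, mem_insert, mem_singleton, not_or]
    refine ⟨a, ?_⟩
    intro e; rw [e] at b; exact b hh
  · rintro ⟨x, y⟩ hp ⟨x', y'⟩ hp' hxy
    simp only [mem_filter, mem_univ, true_and] at hp hp' hxy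
    obtain ⟨hp, hy⟩ := hp
    obtain ⟨hp', hy'⟩ := hp'
    have hx : x = (x / y) * y := by field_simp
    have hx' : x' = (x / y) * y' := by rw [hxy]; field_simp
    rw [hx, hsol _ _ hy] at hp
    rw [hx', hsol _ _ hy'] at hp'
    obtain ⟨a, b⟩ := hA _ _ hy hp
    have b' : (x / y) ^ k + g ≠ 0 := fun e => b (CharTwo.add_eq_zero.mp e)
    have : y = y' := h2.1 (mul_right_cancel₀ b' (hp.symm.trans hp'))
    rw [hx, hx', this]
  · intro t ht
    simp only [mem_sdiff, mem_univ, true_and, mem_insert, mem_singleton, not_or] at ht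
    obtain ⟨ha, hb⟩ := ht
    have hb' : t ^ k + g ≠ 0 := fun e => hb (h1.1 ((CharTwo.add_eq_zero.mp e).trans hh.symm))
    have ha' : t + g ≠ 0 := fun e => ha (CharTwo.add_eq_zero.mp e)
    obtain ⟨y, hy⟩ := h2.2 ((t + g) / (t ^ k + g))
    simp only at hy
    have hy0 : y ≠ 0 := by
      rintro rfl
      rw [zero_pow (by omega)] at hy
      exact div_ne_zero ha' hb' hy.symm
    refine ⟨(t * y, y), ?_, ?_⟩
    · simp only [mem_filter, mem_univ, true_and]
      refine ⟨(hsol t y hy0).mpr ?_, hy0⟩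
      rw [hy]; field_simp
    · simp only; field_simp

end Helpers

section Helpers2
open Finset

variable {F : Type*} [Field F] [Fintype F] [DecidableEq F]

lemma card_sol [CharP F 2] (k : ℕ) (hk : 2 ≤ k)
    (h1 : Function.Bijective (fun x : F => x ^ k))
    (h2 : Function.Bijective (fun x : F => x ^ (k - 1)))
    (h0 : (univ.filter (fun x : F => x + x ^ k = 0)).card = 2) (g : F) (g0 : g ≠ 0) (g1 : g ≠ 1) :
    (univ.filter (fun p : F × F => p.1 + p.1 ^ k = g * (p.2 + p.2 ^ k))).card
      = Fintype.card F := by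
  rw [← card_sol_ne k hk h1 h2 g g0 g1, ← card_filter_add_card_filter_not (fun p : F × F => p.2 ≠ 0),
    filter_filter, filter_filter]
  congr 1
  rw [← h0]
  refine card_bij (fun p _ => p.1) ?_ ?_ ?_
  · rintro ⟨x, y⟩ hp
    simp only [mem_filter, mem_univ, true_and, not_not] at hp ⊢
    obtain ⟨e, rfl⟩ := hp
    rw [e, zero_pow (by omega)]; simp
  · rintro ⟨x, y⟩ hp ⟨x', y'⟩ hp' e
    simp only [mem_filter, mem_univ, true_and, not_not] at hp hp' e
    rw [e, hp.2, hp'.2]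
  · intro x hx
    simp only [mem_filter, mem_univ, true_and] at hx
    refine ⟨(x, 0), ?_, rfl⟩
    simp only [mem_filter, mem_univ, true_and, not_not, and_true]
    rw [hx, zero_pow (by omega)]; simp

lemma card_im (t : F → F)
    (hf : ∀ y ∈ univ.image t, (univ.filter (fun x => t x = y)).card = 2) :
    Fintype.card F = (univ.image t).card * 2 := by
  rw [← card_univ, card_eq_sum_card_image t univ, sum_congr rfl hf, sum_const, smul_eq_mul]

lemma card_pairs (t : F → F) (g : F)
    (hf : ∀ y ∈ univ.image t, (univ.filter (fun x => t x = y)).card = 2) :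
    (univ.filter (fun p : F × F => t p.1 = g * t p.2)).card =
      (((univ.image t) ×ˢ (univ.image t)).filter (fun p => p.1 = g * p.2)).card * 4 := by
  rw [card_eq_sum_card_fiberwise (f := fun p : F × F => (t p.1, t p.2))
    (t := (((univ.image t) ×ˢ (univ.image t)).filter (fun p => p.1 = g * p.2)))]
  · rw [sum_congr rfl (g := fun _ => 4), sum_const, smul_eq_mul]
    rintro ⟨a, b⟩ hab
    simp only [mem_filter, mem_product] at hab
    obtain ⟨⟨ha, hb⟩, e⟩ := hab
    have : (univ.filter (fun p : F × F => t p.1 = g * t p.2)).filter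
        (fun p => (t p.1, t p.2) = (a, b)) =
        (univ.filter (fun x => t x = a)) ×ˢ (univ.filter (fun x => t x = b)) := by
      ext ⟨x, y⟩
      simp only [mem_filter, mem_product, mem_univ, true_and, Prod.mk.injEq]
      constructor
      · exact fun h => h.2
      · rintro ⟨rfl, rfl⟩; exact ⟨e, rfl, rfl⟩
    rw [this, card_product, hf a ha, hf b hb]
  · rintro ⟨x, y⟩ h
    simpa using h

end Helpers2

section Helpers3
open Finset

lemma diffset_aux {F : Type*} [Field F] [Finite F] [CharP F 2] (d k : ℕ) (hd : 2 ≤ d) (hk : 2 ≤ k)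
    (hq : Nat.card F = 2 ^ d)
    (hcop : Nat.Coprime k (2 ^ d - 1))
    (h2to1 : ∀ y : F, (∃ x, x + x ^ k = y) → Nat.card {x : F // x + x ^ k = y} = 2) :
    IsDiffSet (2 ^ d - 1) (2 ^ d / 2 - 1) (2 ^ d / 4 - 1)
      {u : Fˣ | ∃ x : F, x + x ^ k = (u : F)} := by
  classical
  have := Fintype.ofFinite F
  have hcF : Fintype.card F = 2 ^ d := by rw [← hq, Nat.card_eq_fintype_card]
  set t : F → F := fun x => x + x ^ k with ht
  have hf : ∀ y ∈ univ.image t, (univ.filter (fun x => t x = y)).card = 2 := by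
    intro y hy
    simp only [mem_image, mem_univ, true_and] at hy
    rw [← h2to1 y hy, Nat.card_eq_fintype_card, Fintype.card_subtype]
  have ht0 : t 0 = 0 := by simp [ht]; omega
  have ht1 : t 1 = 0 := by simp [ht, CharTwo.add_self_eq_zero]
  have h0mem : (0 : F) ∈ univ.image t := mem_image.mpr ⟨0, mem_univ _, ht0⟩
  have hcu : Nat.card Fˣ = 2 ^ d - 1 := by rw [Nat.card_units, hq]
  have hne : ∀ (n : ℕ) (hn : n ≠ 0) (a : F), a ^ n = 1 → a ≠ 0 := by
    rintro n hn a h rfl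
    rw [zero_pow hn] at h; exact zero_ne_one h
  have h1 : Function.Bijective (fun x : F => x ^ k) := by
    refine pow_bij_of_torsion k (by omega) ?_
    intro a ha
    have ha0 := hne k (by omega) a ha
    have hb : a ^ (2 ^ d - 1) = 1 := by rw [← hcF]; exact FiniteField.pow_card_sub_one_eq_one a ha0
    have := Nat.dvd_gcd (orderOf_dvd_of_pow_eq_one ha) (orderOf_dvd_of_pow_eq_one hb)
    rw [hcop] at this
    exact orderOf_eq_one_iff.mp (Nat.dvd_one.mp this)
  have h2 : Function.Bijective (fun x : F => x ^ (k - 1)) := by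
    refine pow_bij_of_torsion (k - 1) (by omega) ?_
    intro a ha
    have ha0 := hne _ (by omega) a ha
    by_contra ha1
    have hta : t a = 0 := by
      have : a ^ k = a := by
        rw [← Nat.sub_add_cancel (show 1 ≤ k by omega), pow_succ, ha, one_mul]
      simp [ht, this, CharTwo.add_self_eq_zero]
    have hc := hf 0 h0mem
    have hsub : ({0, 1, a} : Finset F) ⊆ univ.filter (fun x => t x = 0) := by
      intro x hx
      simp only [mem_insert, mem_singleton] at hx
      simp only [mem_filter, mem_univ, true_and]
      rcases hx with rfl | rfl | rfl <;> assumption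
    have h3 := card_le_card hsub
    rw [hc, card_eq_three.mpr ⟨0, 1, a, zero_ne_one, Ne.symm ha0, Ne.symm ha1, rfl⟩] at h3
    omega
  have hE := card_im t hf
  rw [hcF] at hE
  refine ⟨hcu, ?_, ?_⟩
  · have : Nat.card {u : Fˣ | ∃ x : F, x + x ^ k = (u : F)} = ((univ.image t).erase 0).card := by
      rw [Nat.card_eq_fintype_card, Fintype.card_subtype]
      refine card_bij (fun u _ => (u : F)) ?_ ?_ ?_
      · intro u hu
        simpa [ht] using hu
      · intro u _ v _ e
        exact Units.ext e
      · intro x hx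
        rw [mem_erase] at hx
        refine ⟨Units.mk0 x hx.1, ?_, rfl⟩
        simpa [ht] using hx.2
    rw [this, card_erase_of_mem h0mem]
    omega
  · intro g hg
    have g1 : (g : F) ≠ 1 := fun e => hg (Units.ext e)
    have hN := card_sol k hk h1 h2 (hf 0 h0mem) (g : F) g.ne_zero g1
    have hP := card_pairs t (g : F) hf
    rw [show (univ.filter (fun p : F × F => t p.1 = g * t p.2)).card = 2 ^ d from hN.trans hcF] at hP
    set P := ((univ.image t) ×ˢ (univ.image t)).filter (fun p => p.1 = (g : F) * p.2) with hPd
    have h00 : ((0 : F), (0 : F)) ∈ P := by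
      rw [hPd, mem_filter, mem_product]
      exact ⟨⟨h0mem, h0mem⟩, by simp⟩
    have : Nat.card {p : Fˣ × Fˣ // p.1 ∈ {u : Fˣ | ∃ x : F, x + x ^ k = (u : F)} ∧
        p.2 ∈ {u : Fˣ | ∃ x : F, x + x ^ k = (u : F)} ∧ p.1 * p.2⁻¹ = g} =
        (P.erase (0, 0)).card := by
      rw [Nat.card_eq_fintype_card, Fintype.card_subtype]
      refine card_bij (fun p _ => ((p.1 : F), (p.2 : F))) ?_ ?_ ?_
      · rintro ⟨u, v⟩ hp
        simp only [mem_filter, mem_univ, true_and, Set.mem_setOf_eq] at hp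
        obtain ⟨hu, hv, e⟩ := hp
        rw [mem_erase, hPd, mem_filter, mem_product]
        refine ⟨by simp, ⟨by simpa [ht] using hu, by simpa [ht] using hv⟩, ?_⟩
        rw [mul_inv_eq_iff_eq_mul] at e
        rw [e]; simp
      · rintro ⟨u, v⟩ _ ⟨u', v'⟩ _ e
        simp only [Prod.mk.injEq] at e
        exact Prod.ext (Units.ext e.1) (Units.ext e.2)
      · rintro ⟨x, y⟩ hx
        rw [mem_erase, hPd, mem_filter, mem_product] at hx
        obtain ⟨hxy, ⟨hx, hy⟩, e⟩ := hx
        simp only at hx hy e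
        have hy0 : y ≠ 0 := by
          rintro rfl
          rw [mul_zero] at e
          exact hxy (by rw [e])
        have hx0 : x ≠ 0 := by rw [e]; exact mul_ne_zero g.ne_zero hy0
        refine ⟨(Units.mk0 x hx0, Units.mk0 y hy0), ?_, rfl⟩
        simp only [mem_filter, mem_univ, true_and, Set.mem_setOf_eq]
        refine ⟨by simpa [ht] using hx, by simpa [ht] using hy, ?_⟩
        rw [mul_inv_eq_iff_eq_mul]
        exact Units.ext e
    rw [this, card_erase_of_mem h00]
    omega

end Helpers3

/-- If `τ(x) = x + x^k` is two-to-one on `F_q`, `q = 2^d`, with `gcd(k, q-1) = 1`, then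
`D_{k,d} = τ(F_q) \ {0}` is a `(q-1, q/2-1, q/4-1)` difference set in `F_qˣ`. -/
theorem stmt_2 (d k : ℕ) (hd : 2 ≤ d) (hk : 2 ≤ k)
    (hcop : Nat.Coprime k (2 ^ d - 1))
    (h2to1 : ∀ y : GaloisField 2 d, (∃ x, x + x ^ k = y) →
      Nat.card {x : GaloisField 2 d // x + x ^ k = y} = 2) :
    IsDiffSet (2 ^ d - 1) (2 ^ d / 2 - 1) (2 ^ d / 4 - 1)
      {u : (GaloisField 2 d)ˣ |
        ∃ x : GaloisField 2 d, x + x ^ k = (u : GaloisField 2 d)} :=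
  diffset_aux d k hd hk (GaloisField.card 2 d (by omega)) hcop h2to1
end

section
/- Let p be a prime, q = p^s, and d ≥ 2. Let G = F_{q^d}^*/F_q^* and let L₀ ⊆ G be the image under the quotient map of the set {x ∈ F_{q^d}^* : Tr(x) = 0}, where Tr is the trace from F_{q^d} to F_q. Then the rank over F_p of the square matrix indexed by G whose (u,v) entry is 1 if v·u⁻¹ ∈ L₀ and 0 otherwise (the p-rank of the Singer difference set L₀) is equal to binomial(p+d−2, d−1)^s + 1. -/
/-- The rank of a (finite) square matrix over a commutative ring `K`. -/
noncomputable def matRank (K : Type*) [CommRing K] {ι : Type*} [Finite ι]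
    (M : Matrix ι ι K) : ℕ :=
  letI : Fintype ι := Fintype.ofFinite ι
  M.rank

namespace Singer

open Finset

/-- Rank is invariant under field extension. -/
theorem rank_map_field {K L ι : Type*} [Field K] [Field L] [Fintype ι]
    (f : K →+* L) (M : Matrix ι ι K) : (M.map f).rank = M.rank := by
  classical
  obtain ⟨V, U, e, hV, hU, h⟩ := M.exists_rank_normal_form
  have h2 := congrArg (fun X : Matrix ι ι K => (X.map f)) h
  simp only [Matrix.map_mul] at h2
  have hV' : IsUnit (V.map f).det := by
    have := (Matrix.isUnit_iff_isUnit_det _).1 (hV.map f.mapMatrix)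
    simpa using this
  have hU' : IsUnit (U.map f).det := by
    have := (Matrix.isUnit_iff_isUnit_det _).1 (hU.map f.mapMatrix)
    simpa using this
  rw [← Matrix.rank_mul_eq_right_of_isUnit_det (V.map f) (M.map f) hV',
    ← Matrix.rank_mul_eq_left_of_isUnit_det (U.map f) (V.map f * M.map f) hU', h2]
  have h3 : (((Matrix.fromBlocks 1 0 0 0 : Matrix (Fin M.rank ⊕ Fin (Fintype.card ι - M.rank))
      (Fin M.rank ⊕ Fin (Fintype.card ι - M.rank)) K).submatrix e e).map f) =
      (Matrix.diagonal (Sum.elim (fun _ => (1:L)) (fun _ => 0))).submatrix e e := by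
    ext i j
    simp only [Matrix.map_apply, Matrix.submatrix_apply, Matrix.diagonal_apply]
    rcases e i with a | a <;> rcases e j with b | b <;>
      simp [Matrix.one_apply, apply_ite f]
  rw [h3, Matrix.rank_submatrix, Matrix.rank_diagonal]
  rw [Fintype.card_subtype, Finset.card_filter, Fintype.sum_sum_type]
  simp

/-- Rank of the pullback along a surjection. -/
theorem rank_pullback {K ι κ : Type*} [Field K] [Fintype ι] [Fintype κ]
    (M : Matrix ι ι K) (f : κ → ι) (hf : Function.Surjective f) :
    (M.submatrix f f).rank = M.rank := by
  apply le_antisymm (Matrix.rank_submatrix_le _ _ _)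
  have h := Matrix.rank_submatrix_le (M.submatrix f f) (Function.surjInv hf) (Function.surjInv hf)
  have h2 : f ∘ Function.surjInv hf = id := funext fun x => Function.surjInv_eq hf x
  rwa [Matrix.submatrix_submatrix, h2, Matrix.submatrix_id_id] at h

theorem rank_chars {K H S : Type*} [Field K] [Group H] [Fintype H] [Fintype S]
    (χ : S → (H →* K)) (hχ : Function.Injective χ) (c : S → K) (hc : ∀ e, c e ≠ 0) :
    (Matrix.of fun u v : H => ∑ e, c e * χ e (v * u⁻¹)).rank = Fintype.card S := by
  classical
  have hli : LinearIndependent K (fun e : S => (fun v : H => χ e v)) :=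
    (linearIndependent_monoidHom H K).comp χ hχ
  let Q : Matrix S H K := Matrix.of fun e v => χ e v
  let P : Matrix H S K := Matrix.of fun u e => χ e u⁻¹
  have hM : (Matrix.of fun u v : H => ∑ e, c e * χ e (v * u⁻¹)) = P * (Matrix.diagonal c * Q) := by
    ext u v
    rw [Matrix.mul_apply]
    simp only [P, Q, Matrix.of_apply, Matrix.diagonal_mul, map_mul]
    exact Finset.sum_congr rfl fun e _ => by ring
  have hP : Function.Injective P.mulVecLin := by
    rw [← LinearMap.ker_eq_bot, LinearMap.ker_eq_bot']
    intro w hw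
    rw [Fintype.linearIndependent_iff] at hli
    funext e
    refine hli w ?_ e
    funext v
    have := congrFun hw v⁻¹
    simp only [Matrix.mulVecLin_apply, Matrix.mulVec, dotProduct, P, Matrix.of_apply, inv_inv] at this
    simpa [mul_comm] using this
  rw [hM, Matrix.rank, Matrix.mulVecLin_mul, LinearMap.range_comp,
    ← (Submodule.equivMapOfInjective P.mulVecLin hP _).finrank_eq]
  change (Matrix.diagonal c * Q).rank = _
  rw [Matrix.rank_mul_eq_right_of_isUnit_det]
  · exact LinearIndependent.rank_matrix (M := Q) hli
  · rw [Matrix.det_diagonal]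
    exact (Finset.prod_ne_zero_iff.2 fun e _ => hc e).isUnit

/-- The index set. -/
abbrev Idx (p s d : ℕ) : Finset (Fin s → Fin d → ℕ) :=
  Fintype.piFinset fun _ : Fin s => piAntidiag (univ : Finset (Fin d)) (p - 1)

theorem card_Idx (p s d : ℕ) (hp : p.Prime) (hd : 2 ≤ d) :
    (Idx p s d).card = (Nat.choose (p + d - 2) (d - 1)) ^ s := by
  rw [Fintype.card_piFinset, Finset.prod_const, ← map_sym_eq_piAntidiag, Finset.card_map,
    sym_univ, Finset.card_univ, Sym.card_sym_eq_choose]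
  have := hp.two_le
  simp only [Fintype.card_fin, Finset.card_univ]
  rw [show d + (p - 1) - 1 = p + d - 2 by omega, 
    ← Nat.choose_symm (show p - 1 ≤ p + d - 2 by omega),
    show p + d - 2 - (p - 1) = d - 1 by omega]

/-- The exponent. -/
def ex (p : ℕ) {s d : ℕ} (a : Fin s → Fin d → ℕ) : ℕ :=
  ∑ k, ∑ i, a k i * p ^ ((k : ℕ) + s * (i : ℕ))

theorem mem_Idx {p s d : ℕ} {a : Fin s → Fin d → ℕ} :
    a ∈ Idx p s d ↔ ∀ k, ∑ i, a k i = p - 1 := by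
  simp [Idx, Fintype.mem_piFinset, mem_piAntidiag]

theorem Idx_le {p s d : ℕ} {a : Fin s → Fin d → ℕ} (ha : a ∈ Idx p s d) (k i) :
    a k i ≤ p - 1 := by
  rw [← mem_Idx.1 ha k]
  exact Finset.single_le_sum (f := a k) (fun _ _ => Nat.zero_le _) (mem_univ i)

theorem ex_eq {p s d : ℕ} (a : Fin s → Fin d → ℕ) (h : ∀ k i, a k i < p) :
    ex p a = (finFunctionFinEquiv (fun j : Fin (d * s) =>
      (⟨a (finProdFinEquiv.symm j).2 (finProdFinEquiv.symm j).1, h _ _⟩ : Fin p)) : ℕ) := by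
  rw [finFunctionFinEquiv_apply, ← finProdFinEquiv.sum_comp, Fintype.sum_prod_type, 
    Finset.sum_comm, ex]
  simp only [Equiv.symm_apply_apply]
  rfl

theorem ex_inj {p s d : ℕ} {a b : Fin s → Fin d → ℕ} (ha : ∀ k i, a k i < p)
    (hb : ∀ k i, b k i < p) (h : ex p a = ex p b) : a = b := by
  rw [ex_eq a ha, ex_eq b hb] at h
  have h2 := finFunctionFinEquiv.injective (Fin.ext h)
  funext k i
  have := congrFun h2 (finProdFinEquiv (i, k))
  simpa using this

theorem ex_lt {p s d : ℕ} (hp : p.Prime) (hs : 0 < s) (hd : 2 ≤ d)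
    {a : Fin s → Fin d → ℕ} (ha : a ∈ Idx p s d) : ex p a < (p ^ s) ^ d - 1 := by
  have h2 := hp.two_le
  have hlt : ∀ k i, a k i < p := fun k i => by have := Idx_le ha k i; omega
  have h1 : ex p a < (p ^ s) ^ d := by
    rw [ex_eq a hlt, ← pow_mul, mul_comm s d]
    exact Fin.is_lt _
  let b : Fin s → Fin d → ℕ := fun _ _ => p - 1
  have hb : ∀ k i, b k i < p := fun k i => by simp only [b]; omega
  have h3 : ex p b < (p ^ s) ^ d := by
    rw [ex_eq b hb, ← pow_mul, mul_comm s d]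
    exact Fin.is_lt _
  have h4 : ex p a < ex p b := by
    refine lt_of_le_of_ne ?_ ?_
    · exact Finset.sum_le_sum fun k _ => Finset.sum_le_sum fun i _ => 
        Nat.mul_le_mul_right _ (Idx_le ha k i)
    · intro h
      have hab := ex_inj hlt hb h
      have h5 := mem_Idx.1 ha ⟨0, hs⟩
      rw [hab] at h5
      simp only [b, sum_const, card_univ, Fintype.card_fin, smul_eq_mul] at h5
      have : 2 * (p - 1) ≤ d * (p - 1) := Nat.mul_le_mul_right _ hd
      omega
  omega

theorem ex_pos {p s d : ℕ} (hp : p.Prime) (hs : 0 < s)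
    {a : Fin s → Fin d → ℕ} (ha : a ∈ Idx p s d) : ex p a ≠ 0 := by
  intro h
  have h2 := hp.two_le
  have h5 := mem_Idx.1 ha ⟨0, hs⟩
  have : ∀ i, a ⟨0, hs⟩ i = 0 := by
    intro i
    rw [ex, Finset.sum_eq_zero_iff] at h
    have := h ⟨0, hs⟩ (mem_univ _)
    rw [Finset.sum_eq_zero_iff] at this
    have := this i (mem_univ _)
    have hpp : p ^ (0 + s * (i:ℕ)) ≠ 0 := pow_ne_zero _ hp.ne_zero
    simpa [hp.ne_zero] using this
  simp [this] at h5
  omega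

theorem expand {p s d : ℕ} {E : Type*} [Field E] [CharP E p] (hp : p.Prime) (x : E) :
    (∑ i ∈ range d, x ^ ((p ^ s) ^ i)) ^ (p ^ s - 1) =
      ∑ a ∈ Idx p s d, (∏ k, (Nat.multinomial univ (a k) : E)) * x ^ ex p a := by
  have := Fact.mk hp
  have h2 := hp.two_le
  have hq : p ^ s - 1 = ∑ k : Fin s, p ^ (k : ℕ) * (p - 1) := by
    rw [← Finset.sum_mul, Fin.sum_univ_eq_sum_range (fun k => p ^ k), 
      geom_sum_mul_of_one_le (by omega)]
  rw [hq, ← Finset.prod_pow_eq_pow_sum, Finset.sum_range]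
  simp_rw [pow_mul, sum_pow_char_pow, Finset.sum_pow_eq_sum_piAntidiag]
  rw [Finset.prod_univ_sum]
  refine Finset.sum_congr rfl fun a _ => ?_
  rw [Finset.prod_mul_distrib, ex, ← Finset.prod_pow_eq_pow_sum]
  congr 1
  refine Finset.prod_congr rfl fun k _ => ?_
  rw [← Finset.prod_pow_eq_pow_sum]
  refine Finset.prod_congr rfl fun i _ => ?_
  simp only [← pow_mul]
  congr 1
  rw [pow_add, pow_mul]
  ring

theorem coeff_ne {p s d : ℕ} {E : Type*} [Field E] [CharP E p] (hp : p.Prime) 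
    {a : Fin s → Fin d → ℕ} (ha : a ∈ Idx p s d) :
    (∏ k, (Nat.multinomial univ (a k) : E)) ≠ 0 := by
  rw [Finset.prod_ne_zero_iff]
  intro k _ h
  rw [CharP.cast_eq_zero_iff E p] at h
  have h1 := Nat.multinomial_spec univ (a k)
  rw [mem_Idx.1 ha k] at h1
  have h2 : p ∣ (p - 1).factorial := h1 ▸ Dvd.dvd.mul_left h _
  have := (hp.dvd_factorial).1 h2
  have := hp.two_le
  omega

end Singer

open scoped Classical in
/-- The `p`-rank of the Singer difference set `L₀` in `G = F_{q^d}ˣ/F_qˣ`, `q = p^s`,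
equals `binomial (p+d-2) (d-1) ^ s + 1`. -/
theorem stmt_4 (p s d : ℕ) (hp : p.Prime) (hs : 0 < s) (hd : 2 ≤ d)
    (F E : Type*) [Field F] [Field E] [Algebra F E] [Fintype F] [Fintype E]
    (hF : Fintype.card F = p ^ s) (hE : Fintype.card E = (p ^ s) ^ d) :
    matRank (ZMod p)
      (Matrix.of fun u v : Eˣ ⧸ (Units.map (algebraMap F E).toMonoidHom).range =>
        if v * u⁻¹ ∈
            (QuotientGroup.mk (s := (Units.map (algebraMap F E).toMonoidHom).range) ''
              {x : Eˣ | Algebra.trace F E (x : E) = 0}) then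
          (1 : ZMod p) else 0) =
      (Nat.choose (p + d - 2) (d - 1)) ^ s + 1 := by
  have hpf := Fact.mk hp
  have hcE : CharP E p := by
    have hE' : Fintype.card E = p ^ (s * d) := by rw [hE, pow_mul]
    exact charP_of_card_eq_prime_pow hE'
  have hfr : Module.finrank F E = d := by
    have h := Module.card_eq_pow_finrank (K := F) (V := E)
    rw [hE, hF] at h
    exact (Nat.pow_right_injective (Nat.one_lt_pow hs.ne' hp.one_lt) h).symm
  rw [matRank]
  let _ : Fintype (Eˣ ⧸ (Units.map (algebraMap F E).toMonoidHom).range) := Fintype.ofFinite _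
  rw [← Singer.rank_map_field (ZMod.castHom (dvd_refl p) E),
    ← Singer.rank_pullback _ (QuotientGroup.mk) QuotientGroup.mk_surjective]
  let χ : Option (Singer.Idx p s d) → (Eˣ →* E) := fun o =>
    (Units.coeHom E).comp (powMonoidHom (o.elim 0 fun a => Singer.ex p a.1))
  let c : Option (Singer.Idx p s d) → E := fun o =>
    o.elim 1 fun a => - ∏ k, (Nat.multinomial Finset.univ (a.1 k) : E)
  have hc : ∀ e, c e ≠ 0 := by
    rintro (_ | a)
    · exact one_ne_zero
    · exact neg_ne_zero.2 (Singer.coeff_ne hp a.2)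
  have hlt : ∀ o : Option (Singer.Idx p s d), 
      (o.elim 0 fun a => Singer.ex p a.1) < (p ^ s) ^ d - 1 := by
    rintro (_ | a)
    · have : 1 < (p ^ s) ^ d := Nat.one_lt_pow (by omega) (Nat.one_lt_pow hs.ne' hp.one_lt)
      simp only [Option.elim]
      omega
    · exact Singer.ex_lt hp hs hd a.2
  have hχ : Function.Injective χ := by
    obtain ⟨g, hg⟩ := IsCyclic.exists_generator (α := Eˣ)
    have ho : orderOf g = (p ^ s) ^ d - 1 := by
      rw [orderOf_eq_card_of_forall_mem_zpowers hg, Nat.card_eq_fintype_card, 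
        Fintype.card_units, hE]
    intro o o' h
    have h1 := DFunLike.congr_fun h g
    have h2 := Units.val_injective h1
    have h3 := pow_injOn_Iio_orderOf (x := g) (by rw [ho]; exact hlt o) (by rw [ho]; exact hlt o') h2
    have hp2 := hp.two_le
    rcases o with _ | a <;> rcases o' with _ | b
    · rfl
    · exact absurd h3.symm (Singer.ex_pos hp hs b.2)
    · exact absurd h3 (Singer.ex_pos hp hs a.2)
    · congr 1
      apply Subtype.ext
      refine Singer.ex_inj (fun k i => ?_) (fun k i => ?_) h3
      · have := Singer.Idx_le a.2 k i; omega
      · have := Singer.Idx_le b.2 k i; omega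
  have key := Singer.rank_chars χ hχ c hc
  rw [Fintype.card_option, Fintype.card_coe, Singer.card_Idx p s d hp hd] at key
  rw [← key]
  congr 1
  ext u v
  simp only [Matrix.submatrix_apply, Matrix.map_apply, Matrix.of_apply]
  have hmem : ((v : Eˣ ⧸ (Units.map (algebraMap F E).toMonoidHom).range) *
      (u : Eˣ ⧸ (Units.map (algebraMap F E).toMonoidHom).range)⁻¹ ∈
      (QuotientGroup.mk (s := (Units.map (algebraMap F E).toMonoidHom).range) ''
              {x : Eˣ | Algebra.trace F E (x : E) = 0})) ↔
      Algebra.trace F E ((v * u⁻¹ : Eˣ) : E) = 0 := by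
    rw [← QuotientGroup.mk_inv, ← QuotientGroup.mk_mul]
    constructor
    · rintro ⟨x, hx, hxe⟩
      obtain ⟨y, hy⟩ := QuotientGroup.eq.1 hxe
      have : v * u⁻¹ = Units.map (algebraMap F E).toMonoidHom y * x := by
        rw [hy, mul_comm x⁻¹, inv_mul_cancel_right]
      rw [this]
      have h0 : ((Units.map (algebraMap F E).toMonoidHom y * x : Eˣ) : E) = (y : F) • (x : E) := by
        rw [Algebra.smul_def]; rfl
      rw [h0, map_smul, show Algebra.trace F E (x : E) = 0 from hx, smul_zero]
    · intro h
      exact ⟨_, h, rfl⟩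
  have hsum : ∑ e, c e * χ e (v * u⁻¹) = 
      1 - (algebraMap F E (Algebra.trace F E ((v * u⁻¹ : Eˣ) : E))) ^ (p ^ s - 1) := by
    rw [FiniteField.algebraMap_trace_eq_sum_pow, hfr, Nat.card_eq_fintype_card, hF, 
      Singer.expand hp, Fintype.sum_option, sub_eq_add_neg,
      ← Finset.sum_neg_distrib]
    refine congrArg₂ (· + ·) ?_ ?_
    · simp [c, χ]
    · rw [← Finset.sum_coe_sort (Singer.Idx p s d)]
      refine Finset.sum_congr rfl fun a _ => ?_
      simp [c, χ]
  rw [hsum]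
  by_cases h : Algebra.trace F E ((v * u⁻¹ : Eˣ) : E) = 0
  · rw [if_pos (hmem.2 h), h, map_zero, zero_pow, map_one, sub_zero]
    have : 1 < p ^ s := Nat.one_lt_pow hs.ne' hp.one_lt
    omega
  · rw [if_neg (fun h' => h (hmem.1 h')), ← map_pow, ← hF, 
      FiniteField.pow_card_sub_one_eq_one _ h, map_one, sub_self, map_zero]
end

section
/- Let d ≥ 2, q = 2^d, and let k ≥ 2 be an integer with gcd(k, q−1) = 1 and gcd(k−1, q−1) = 1, such that the map τ : F_q → F_q, τ(x) = x + x^k, is two-to-one (every element of τ(F_q) has exactly two preimages). Then the 2-rank of the complement F_q^* \ D_{k,d} is equal to B_k(d), the number of integers a with 0 < a < 2^d−1 such that s(a) + s((k−1)a) = s(ka) + 1. -/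
/-- `sBin d x` is the number of 1's in the binary representation of the reduction of `x`
modulo `2^d - 1`. -/
def sBin (d x : ℕ) : ℕ := (Nat.digits 2 (x % (2 ^ d - 1))).count 1

/-- `B k d` is the number of `a` with `0 < a < 2^d - 1` such that
`s(a) + s((k-1)a) = s(ka) + 1`. -/
def B (k d : ℕ) : ℕ :=
  ((Finset.Ioo 0 (2 ^ d - 1)).filter
    (fun a => sBin d a + sBin d ((k - 1) * a) = sBin d (k * a) + 1)).card

/-- binary digit count -/
def bc (x : ℕ) : ℕ := (Nat.digits 2 x).count 1

lemma bc_zero : bc 0 = 0 := by simp [bc]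

lemma bc_even (x : ℕ) : bc (2 * x) = bc x := by
  rcases Nat.eq_zero_or_pos x with rfl | h
  · simp
  · have := Nat.digits_add 2 (by norm_num) 0 x (by norm_num) (Or.inr h.ne')
    rw [zero_add] at this
    simp [bc, this]

lemma bc_odd (x : ℕ) : bc (2 * x + 1) = bc x + 1 := by
  have := Nat.digits_add 2 (by norm_num) 1 x (by norm_num) (Or.inl (by norm_num))
  rw [add_comm] at this
  rw [bc, this, List.count_cons_self, bc]

lemma bc_step (x : ℕ) : bc x = bc (x / 2) + x % 2 := by
  rcases Nat.mod_two_eq_zero_or_one x with h | h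
  · conv_lhs => rw [show x = 2 * (x / 2) by omega]
    rw [bc_even, h, add_zero]
  · conv_lhs => rw [show x = 2 * (x / 2) + 1 by omega]
    rw [bc_odd, h]

lemma bc_eq_sum (x : ℕ) : (Nat.digits 2 x).sum = bc x := by
  induction x using Nat.strong_induction_on with
  | _ x ih =>
    rcases Nat.eq_zero_or_pos x with rfl | h
    · simp [bc]
    · rw [bc_step, ← ih (x / 2) (by omega), Nat.digits_def' (by norm_num) h]
      simp [add_comm]

lemma bc_compl (d : ℕ) : ∀ x y : ℕ, x + y + 1 = 2 ^ d → bc x + bc y = d := by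
  induction d with
  | zero => intro x y h; obtain ⟨rfl, rfl⟩ : x = 0 ∧ y = 0 := by simp at h; omega
            simp [bc]
  | succ d ih =>
    intro x y h
    rw [pow_succ] at h
    have := ih (x / 2) (y / 2) (by omega)
    rw [bc_step x, bc_step y]
    omega

lemma bc_top (d : ℕ) : ∀ t : ℕ, t < 2 ^ d → bc (2 ^ d + t) = bc t + 1 := by
  induction d with
  | zero => intro t h; obtain rfl : t = 0 := by simp at h; omega
            simp [bc]
  | succ d ih =>
    intro t h
    rw [pow_succ] at h ⊢
    have := ih (t / 2) (by omega)
    rw [bc_step (2 ^ d * 2 + t), bc_step t, show (2 ^ d * 2 + t) / 2 = 2 ^ d + t / 2 by omega]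
    omega

lemma bc_carry (d : ℕ) : ∀ x y c e : ℕ, e ≤ 1 → x < 2 ^ (d + 1) → y < 2 ^ (d + 1) →
    x + y + e = c + 2 ^ (d + 1) → bc c + 2 ≤ bc x + bc y + e := by
  induction d with
  | zero =>
    intro x y c e he hx hy h
    have : x ≤ 1 := by simp at hx; omega
    have : y ≤ 1 := by simp at hy; omega
    have : c ≤ 1 := by simp at h; omega
    interval_cases x <;> interval_cases y <;> interval_cases c <;> simp [bc] at * <;> omega
  | succ d ih =>
    intro x y c e he hx hy h
    rw [pow_succ] at h hx hy
    have := ih (x / 2) (y / 2) (c / 2) ((x % 2 + y % 2 + e) / 2) (by omega) (by omega) (by omega)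
      (by omega)
    rw [bc_step x, bc_step y, bc_step c]
    omega

lemma sBin_eq (d x : ℕ) : sBin d x = bc (x % (2 ^ d - 1)) := rfl

lemma sBin_congr {d x y : ℕ} (h : x ≡ y [MOD (2 ^ d - 1)]) : sBin d x = sBin d y := by
  rw [sBin_eq, sBin_eq, h]

lemma sBin_two_mul (d x : ℕ) (hd : 2 ≤ d) : sBin d (2 * x) = sBin d x := by
  obtain ⟨m, rfl⟩ : ∃ m, d = m + 1 := ⟨d - 1, by omega⟩
  have hp : 2 ^ (m + 1) = 2 * 2 ^ m := by ring
  have hp1 : 1 < 2 ^ m := Nat.one_lt_two_pow (by omega)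
  rw [sBin_eq, sBin_eq]
  set n := 2 ^ (m + 1) - 1 with hn
  have hr : x % n < n := Nat.mod_lt _ (by omega)
  have h2 : (2 * x) % n = (2 * (x % n)) % n := by simp [Nat.mul_mod]
  rw [h2]
  generalize x % n = r at *
  by_cases h : 2 * r < n
  · rw [Nat.mod_eq_of_lt h, bc_even]
  · rw [Nat.mod_eq_sub_mod (by omega), Nat.mod_eq_of_lt (by omega)]
    obtain ⟨t, rfl⟩ : ∃ t, r = 2 ^ m + t := ⟨r - 2 ^ m, by omega⟩
    rw [bc_top _ _ (by omega), show 2 * (2 ^ m + t) - n = 2 * t + 1 by omega, bc_odd]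

/-- the combinatorial core -/
lemma choose_core (d a b c : ℕ) (hd : 2 ≤ d) (ha : 0 < a) (han : a < 2 ^ d - 1) (hb : b % 2 = 1)
    (hbn : b < 2 ^ d - 1) (hc : c < 2 ^ d - 1) (hc0 : 0 < c) (habc : a + b ≡ c [MOD (2 ^ d - 1)])
    (heven : 2 ∣ (2 ^ d - 1 - b).choose a) :
    ¬ 4 ∣ (2 ^ d - 1 - b).choose a ↔ bc a + bc b = bc c + 1 := by
  have hq : 4 ≤ 2 ^ d := by
    calc 4 = 2 ^ 2 := by norm_num
      _ ≤ 2 ^ d := Nat.pow_le_pow_right (by norm_num) hd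
  have hcm : (a + b) % (2 ^ d - 1) = c := by
    rw [habc]; exact Nat.mod_eq_of_lt hc
  by_cases hab : a + b < 2 ^ d - 1
  · rw [Nat.mod_eq_of_lt hab] at hcm
    subst hcm
    have h0 : (2 ^ d - 1 - b).choose a ≠ 0 := Nat.choose_ne_zero (by omega)
    have : Fact (Nat.Prime 2) := ⟨Nat.prime_two⟩
    have hk := sub_one_mul_padicValNat_choose_eq_sub_sum_digits (p := 2)
      (k := a) (n := 2 ^ d - 1 - b) (by omega)
    rw [bc_eq_sum, bc_eq_sum, bc_eq_sum] at hk
    have e1 := bc_compl d (2 ^ d - 1 - b - a) (a + b) (by omega)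
    have e2 := bc_compl d (2 ^ d - 1 - b) b (by omega)
    have hv1 := (padicValNat_dvd_iff_le (p := 2) (n := 1) h0).1 (by simpa using heven)
    have hv2 := padicValNat_dvd_iff_le (p := 2) (n := 2) h0
    norm_num at hv2
    rw [hv2]
    omega
  · have hab' : 2 ^ d - 1 < a + b := by
      rcases lt_or_eq_of_le (not_lt.1 hab) with h | h
      · exact h
      · rw [← h, Nat.mod_self] at hcm; omega
    rw [Nat.choose_eq_zero_of_lt (by omega)]
    rw [Nat.mod_eq_sub_mod (by omega), Nat.mod_eq_of_lt (by omega)] at hcm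
    obtain ⟨m, rfl⟩ : ∃ m, d = m + 1 + 1 := ⟨d - 2, by omega⟩
    rw [pow_succ] at *
    have := bc_carry m (a / 2) (b / 2) (c / 2) 1 le_rfl (by omega) (by omega) (by omega)
    rw [bc_step a, bc_step b, bc_step c]
    simp
    omega

lemma rank_map_field {K L ι : Type*} [Field K] [Field L] [Fintype ι] [DecidableEq ι] (f : K →+* L)
    (M : Matrix ι ι K) : (M.map f).rank = M.rank := by
  classical
  obtain ⟨P, Q, D, h⟩ := Matrix.Pivot.exists_list_transvec_mul_diagonal_mul_list_transvec M
  set P' := (P.map Matrix.TransvectionStruct.toMatrix).prod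
  set Q' := (Q.map Matrix.TransvectionStruct.toMatrix).prod
  have hP : P'.det = 1 := Matrix.TransvectionStruct.det_toMatrix_prod P
  have hQ : Q'.det = 1 := Matrix.TransvectionStruct.det_toMatrix_prod Q
  have hP' : (P'.map f).det = 1 := by
    rw [← RingHom.mapMatrix_apply, ← RingHom.map_det, hP, map_one]
  have hQ' : (Q'.map f).det = 1 := by
    rw [← RingHom.mapMatrix_apply, ← RingHom.map_det, hQ, map_one]
  rw [h, Matrix.map_mul, Matrix.map_mul, Matrix.rank_mul_eq_left_of_isUnit_det _ _ (by simp [hQ']),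
    Matrix.rank_mul_eq_right_of_isUnit_det _ _ (by simp [hP']),
    Matrix.rank_mul_eq_left_of_isUnit_det _ _ (by simp [hQ]),
    Matrix.rank_mul_eq_right_of_isUnit_det _ _ (by simp [hP]), Matrix.diagonal_map (map_zero f),
    Matrix.rank_diagonal, Matrix.rank_diagonal]
  apply Fintype.card_congr
  exact Equiv.subtypeEquivRight (fun i => by simp)

lemma sum_eq_zero_add_units {F W : Type*} [Field F] [Fintype F] [DecidableEq F]
    [AddCommMonoid W] (f : F → W) : ∑ x, f x = f 0 + ∑ u : Fˣ, f u := by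
  rw [← Finset.add_sum_erase _ _ (Finset.mem_univ (0 : F))]
  congr 1
  symm
  refine Finset.sum_bij (fun u _ => (u : F)) ?_ ?_ ?_ ?_
  · intro u _; simp
  · intro u _ v _ h; exact Units.ext h
  · intro x hx
    exact ⟨Units.mk0 x (Finset.ne_of_mem_erase hx), Finset.mem_univ _, rfl⟩
  · intro u _; rfl

lemma sum_units_pow {F W : Type*} [Field F] [Fintype F] [DecidableEq F]
    [CommRing W] [IsDomain W] (T : F →* W) (hT : Function.Injective T) (m : ℕ) :
    ∑ u : Fˣ, T u ^ m =
      if (Fintype.card F - 1) ∣ m then ((Fintype.card F - 1 : ℕ) : W) else 0 := by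
  classical
  have h := sum_hom_units ((powMonoidHom m).comp (T.comp (Units.coeHom F)))
  have hiff : (powMonoidHom m).comp (T.comp (Units.coeHom F)) = 1 ↔ (Fintype.card F - 1) ∣ m := by
    rw [← FiniteField.forall_pow_eq_one_iff, MonoidHom.ext_iff]
    refine forall_congr' fun u => ?_
    simp only [MonoidHom.comp_apply, powMonoidHom_apply, MonoidHom.one_apply, Units.coeHom_apply]
    rw [← map_pow, ← map_one T, hT.eq_iff, ← Units.val_pow_eq_pow_val, Units.val_eq_one]
  simp only [MonoidHom.comp_apply, powMonoidHom_apply, Units.coeHom_apply] at h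
  rw [h]
  simp only [hiff, Fintype.card_units]
  split_ifs <;> simp

lemma sum_field_pow {F W : Type*} [Field F] [Fintype F] [DecidableEq F]
    [CommRing W] [IsDomain W] (T : F →* W) (hT : Function.Injective T) (h0 : T 0 = 0)
    (m : ℕ) (hm : 0 < m) :
    ∑ x : F, T x ^ m =
      if (Fintype.card F - 1) ∣ m then ((Fintype.card F - 1 : ℕ) : W) else 0 := by
  rw [sum_eq_zero_add_units, sum_units_pow T hT, h0, zero_pow hm.ne', zero_add]

section core

variable {F W : Type*} [Field F] [Fintype F] [DecidableEq F] [CharP F 2]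
    [CommRing W] [IsDomain W] (T : F →* W) (π : W →+* F)

lemma teich_sq (hπ : ∀ x, π (T x) = x)
    (hker : ∀ w, π w = 0 ↔ (2 : W) ∣ w)
    (y : F) (e : ℕ) (he : 2 ∣ e) : (4 : W) ∣ T (1 + y) ^ e - (1 + T y) ^ e := by
  obtain ⟨c, rfl⟩ := he
  have h : (2 : W) ∣ T (1 + y) - (1 + T y) := by
    rw [← hker]; simp [hπ]
  obtain ⟨w, hw⟩ := h
  rw [pow_mul, pow_mul]
  refine dvd_trans ⟨(1 + T y) * w + w ^ 2, ?_⟩ (sub_dvd_pow_sub_pow _ _ c)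
  rw [sub_eq_iff_eq_add] at hw
  rw [hw]; ring

lemma jac_mod4 (h0 : T 0 = 0)
    (hπ : ∀ x, π (T x) = x)
    (hker : ∀ w, π w = 0 ↔ (2 : W) ∣ w)
    (k e a : ℕ) (hk : 2 ≤ k) (he : 2 ∣ e) (he0 : 0 < e)
    (hen : e < Fintype.card F - 1) (ha : a < Fintype.card F - 1)
    (hcop : Nat.Coprime (k - 1) (Fintype.card F - 1))
    (hea : (Fintype.card F - 1) ∣ e + (k - 1) * a) :
    (4 : W) ∣ ∑ x : F, T (x + x ^ k) ^ e - ((Fintype.card F - 1 : ℕ) : W) * (e.choose a : W) := by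
  have hinj : Function.Injective T := fun x y h => by rw [← hπ x, h, hπ]
  have key : ∑ x : F, T x ^ e * (1 + T (x ^ (k - 1))) ^ e
      = ((Fintype.card F - 1 : ℕ) : W) * (e.choose a : W) := by
    have : ∀ x : F, T x ^ e * (1 + T (x ^ (k - 1))) ^ e =
        ∑ j ∈ Finset.range (e + 1), (e.choose j : W) * T x ^ (e + (k - 1) * j) := by
      intro x
      rw [add_comm, add_pow, Finset.mul_sum]
      refine Finset.sum_congr rfl fun j _ => ?_
      rw [map_pow, pow_add, pow_mul]; ring
    simp_rw [this]
    rw [Finset.sum_comm]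
    simp_rw [← Finset.mul_sum]
    rw [Finset.sum_eq_single a]
    · rw [sum_field_pow T hinj h0 _ (by omega), if_pos hea, mul_comm]
    · intro j hj hja
      rw [sum_field_pow T hinj h0 _ (by omega), if_neg, mul_zero]
      intro hdiv
      apply hja
      have hj' : j < Fintype.card F - 1 := by
        have := Finset.mem_range.1 hj; omega
      have hm : (k - 1) * j ≡ (k - 1) * a [MOD (Fintype.card F - 1)] := by
        apply Nat.ModEq.add_left_cancel' e
        exact ((Nat.modEq_zero_iff_dvd).2 hdiv).trans ((Nat.modEq_zero_iff_dvd).2 hea).symm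
      have hm' : j ≡ a [MOD (Fintype.card F - 1)] :=
        Nat.ModEq.cancel_left_of_coprime hcop.symm hm
      exact Nat.ModEq.eq_of_lt_of_lt hm' hj' ha
    · intro hna
      rw [Nat.choose_eq_zero_of_lt (by simp at hna; omega)]
      simp
  rw [← key, ← Finset.sum_sub_distrib]
  refine Finset.dvd_sum fun x _ => ?_
  have : x + x ^ k = x * (1 + x ^ (k - 1)) := by
    rw [mul_add, mul_one, ← pow_succ', Nat.sub_add_cancel (by omega)]
  rw [this, map_mul, mul_pow, ← mul_sub]
  exact Dvd.dvd.mul_left (teich_sq T π hπ hker _ e he) _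

lemma two_dvd_cast (hker : ∀ w, π w = 0 ↔ (2 : W) ∣ w)
    (m : ℕ) : (2 : W) ∣ (m : W) ↔ 2 ∣ m := by
  rw [← hker, map_natCast, CharP.cast_eq_zero_iff F 2]

lemma four_dvd_cast (hker : ∀ w, π w = 0 ↔ (2 : W) ∣ w)
    (h2 : (2 : W) ≠ 0)
    (m : ℕ) : (4 : W) ∣ (m : W) ↔ 4 ∣ m := by
  constructor
  · intro h
    have h' : 2 ∣ m := (two_dvd_cast π hker m).1 (dvd_trans ⟨2, by norm_num⟩ h)
    obtain ⟨c, rfl⟩ := h'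
    have h4 : (4 : W) = 2 * 2 := by norm_num
    rw [Nat.cast_mul, h4] at h
    have := (two_dvd_cast π hker c).1 ((mul_dvd_mul_iff_left h2).1 (by simpa using h))
    omega
  · rintro ⟨c, rfl⟩
    exact ⟨c, by push_cast; ring⟩

lemma image_sum_iff (h0 : T 0 = 0)
    (hπ : ∀ x, π (T x) = x)
    (hker : ∀ w, π w = 0 ↔ (2 : W) ∣ w)
    (h2 : (2 : W) ≠ 0)
    (k e a : ℕ) (hk : 2 ≤ k) (he : 2 ∣ e) (he0 : 0 < e)
    (hen : e < Fintype.card F - 1) (ha : a < Fintype.card F - 1)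
    (hodd : Odd (Fintype.card F - 1))
    (hcop : Nat.Coprime (k - 1) (Fintype.card F - 1))
    (hea : (Fintype.card F - 1) ∣ e + (k - 1) * a)
    (h2to1 : ∀ y ∈ Finset.univ.image (fun x : F => x + x ^ k),
      (Finset.univ.filter (fun x : F => x + x ^ k = y)).card = 2) :
    2 ∣ e.choose a ∧
      (∑ y ∈ Finset.univ.image (fun x : F => x + x ^ k), y ^ e ≠ 0 ↔ ¬ 4 ∣ e.choose a) := by
  have hJ := jac_mod4 T π h0 hπ hker k e a hk he he0 hen ha hcop hea
  have hS : ∑ x : F, T (x + x ^ k) ^ e =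
      2 * ∑ y ∈ Finset.univ.image (fun x : F => x + x ^ k), T y ^ e := by
    rw [Finset.sum_comp (fun y => T y ^ e) (fun x : F => x + x ^ k), Finset.mul_sum]
    refine Finset.sum_congr rfl fun y hy => ?_
    rw [h2to1 y hy]; simp
  set S := ∑ y ∈ Finset.univ.image (fun x : F => x + x ^ k), T y ^ e with hSdef
  rw [hS, ← Nat.cast_mul] at hJ
  have hπS : π S = ∑ y ∈ Finset.univ.image (fun x : F => x + x ^ k), y ^ e := by
    rw [hSdef, map_sum]; simp [hπ]
  have h24 : (2 : W) ∣ 4 := ⟨2, by norm_num⟩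
  have h4 : (4 : W) = 2 * 2 := by norm_num
  have c2 : Nat.Coprime 2 (Fintype.card F - 1) := hodd.coprime_two_left
  have c4 : Nat.Coprime 4 (Fintype.card F - 1) := Nat.Coprime.pow_left 2 c2
  constructor
  · have := (dvd_sub_right (Dvd.intro _ rfl)).1 (dvd_trans h24 hJ)
    rw [two_dvd_cast π hker] at this
    exact c2.dvd_of_dvd_mul_left this
  · rw [← hπS, Ne, hker, not_iff_not, ← mul_dvd_mul_iff_left h2, ← h4, dvd_iff_dvd_of_dvd_sub hJ,
      four_dvd_cast π hker h2]
    exact ⟨fun h => c4.dvd_of_dvd_mul_left h, fun h => Dvd.dvd.mul_left h _⟩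

end core

/-- removal of the lift -/
lemma image_sum_iff' {F : Type*} [Field F] [Fintype F] [DecidableEq F] [CharP F 2]
    (k e a : ℕ) (hk : 2 ≤ k) (he : 2 ∣ e) (he0 : 0 < e)
    (hen : e < Fintype.card F - 1) (ha : a < Fintype.card F - 1)
    (hodd : Odd (Fintype.card F - 1))
    (hcop : Nat.Coprime (k - 1) (Fintype.card F - 1))
    (hea : (Fintype.card F - 1) ∣ e + (k - 1) * a)
    (h2to1 : ∀ y ∈ Finset.univ.image (fun x : F => x + x ^ k),
      (Finset.univ.filter (fun x : F => x + x ^ k = y)).card = 2) :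
    2 ∣ e.choose a ∧
      (∑ y ∈ Finset.univ.image (fun x : F => x + x ^ k), y ^ e ≠ 0 ↔ ¬ 4 ∣ e.choose a) := by
  have : Fact (Nat.Prime 2) := ⟨Nat.prime_two⟩
  refine image_sum_iff (W := WittVector 2 F) (WittVector.teichmuller 2)
    WittVector.constantCoeff (WittVector.teichmuller_zero 2) ?_ ?_ ?_ k e a hk he he0 hen ha hodd
    hcop hea h2to1
  · intro x; exact WittVector.teichmuller_coeff_zero 2 x
  · intro w
    rw [← RingHom.mem_ker, WittVector.ker_constantCoeff, Ideal.mem_span_singleton]; simp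
  · exact_mod_cast WittVector.p_nonzero 2 F

/-- main pointwise equivalence -/
lemma pointwise {F : Type*} [Field F] [Fintype F] [DecidableEq F] [CharP F 2]
    (d k : ℕ) (hd : 2 ≤ d) (hk : 2 ≤ k) (hF : Fintype.card F = 2 ^ d)
    (h1 : Nat.Coprime k (2 ^ d - 1)) (h2 : Nat.Coprime (k - 1) (2 ^ d - 1))
    (h2to1 : ∀ y ∈ Finset.univ.image (fun x : F => x + x ^ k),
      (Finset.univ.filter (fun x : F => x + x ^ k = y)).card = 2) (N : ℕ) :
    ∀ a e : ℕ, ¬ (2 ^ d - 1) ∣ a → (2 ^ d - 1) ∣ e + (k - 1) * a → 0 < e →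
      (if ((k - 1) * a) % (2 ^ d - 1) % 2 = 1 then 1
        else (2 ^ d - 1) - ((k - 1) * a) % (2 ^ d - 1) + 1) ≤ N →
      (∑ y ∈ Finset.univ.image (fun x : F => x + x ^ k), y ^ e ≠ 0 ↔
        sBin d a + sBin d ((k - 1) * a) = sBin d (k * a) + 1) := by
  have hq : 4 ≤ 2 ^ d := by
    calc 4 = 2 ^ 2 := by norm_num
      _ ≤ 2 ^ d := Nat.pow_le_pow_right (by norm_num) hd
  have heven : 2 ∣ 2 ^ d := dvd_pow_self _ (by omega)
  set n := 2 ^ d - 1 with hn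
  induction N with
  | zero =>
    intro a e _ _ _ h
    split_ifs at h <;> omega
  | succ N ih =>
    intro a e ha hea he0 hN
    have hb0 : 0 < ((k - 1) * a) % n := by
      apply Nat.pos_of_ne_zero
      intro h
      exact ha (h2.symm.dvd_of_dvd_mul_left (Nat.dvd_of_mod_eq_zero h))
    have hbn := Nat.mod_lt ((k - 1) * a) (show 0 < n by omega)
    by_cases hodd : ((k - 1) * a) % n % 2 = 1
    · -- direct case
      set b := ((k - 1) * a) % n with hb
      have han := Nat.mod_lt a (show 0 < n by omega)
      have ha0 : 0 < a % n := Nat.pos_of_ne_zero fun h => ha (Nat.dvd_of_mod_eq_zero h)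
      have hc0 : 0 < (k * a) % n := by
        apply Nat.pos_of_ne_zero
        intro h
        exact ha (h1.symm.dvd_of_dvd_mul_left (Nat.dvd_of_mod_eq_zero h))
      have hcn := Nat.mod_lt (k * a) (show 0 < n by omega)
      have hdiv : n ∣ (n - b) + (k - 1) * (a % n) := by
        rw [← Nat.modEq_zero_iff_dvd]
        have e1 : (k - 1) * (a % n) ≡ b [MOD n] :=
          ((Nat.mod_modEq a n).mul_left _).trans (Nat.mod_modEq _ n).symm
        have e2 := e1.add_left (n - b)
        rw [Nat.sub_add_cancel hbn.le] at e2
        exact e2.trans (by simp [Nat.ModEq])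
      have hm := image_sum_iff' (F := F) k (n - b) (a % n) hk (by omega) (by omega)
        (by rw [hF]; omega) (by rw [hF]; omega) (by rw [hF, Nat.odd_iff]; omega)
        (by rw [hF]; exact h2) (by rw [hF]; exact hdiv) h2to1
      have hsum : ∀ y : F, y ^ e = y ^ (n - b) := by
        intro y
        rcases eq_or_ne y 0 with rfl | hy
        · rw [zero_pow (by omega), zero_pow (by omega)]
        · have hy1 : y ^ n = 1 := by
            have := FiniteField.pow_card_sub_one_eq_one y hy
            rwa [hF] at this
          have hme : e ≡ n - b [MOD n] := by
            have e1 : (k - 1) * (a % n) ≡ (k - 1) * a [MOD n] := (Nat.mod_modEq a n).mul_left _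
            apply Nat.ModEq.add_right_cancel' ((k - 1) * a)
            exact ((Nat.modEq_zero_iff_dvd).2 hea).trans
              (((Nat.modEq_zero_iff_dvd).2 hdiv).symm.trans (e1.add_left _))
          rw [pow_eq_pow_mod e hy1, pow_eq_pow_mod (n - b) hy1, hme]
      simp_rw [hsum]
      rw [hm.2]
      refine choose_core d (a % n) b ((k * a) % n) hd ha0 han hodd hbn hcn hc0 ?_ hm.1
      have e1 : a % n + b ≡ a + (k - 1) * a [MOD n] := (Nat.mod_modEq a n).add (Nat.mod_modEq _ n)
      have e2 : a + (k - 1) * a = k * a := by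
        obtain ⟨k', rfl⟩ : ∃ k', k = k' + 1 := ⟨k - 1, by omega⟩
        simp; ring
      rw [e2] at e1
      exact e1.trans (Nat.mod_modEq _ n).symm
    · have hcop2 : Nat.Coprime n 2 := by
        apply Nat.Coprime.symm
        apply Odd.coprime_two_left
        rw [Nat.odd_iff]; omega
      have hsq : ∑ y ∈ Finset.univ.image (fun x : F => x + x ^ k), y ^ (2 * e) =
          (∑ y ∈ Finset.univ.image (fun x : F => x + x ^ k), y ^ e) ^ 2 := by
        have : Fact (Nat.Prime 2) := ⟨Nat.prime_two⟩
        rw [sum_pow_char 2]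
        refine Finset.sum_congr rfl fun y _ => by rw [← pow_mul, mul_comm]
      have hmod : ((k - 1) * (2 * a)) % n = (2 * (((k - 1) * a) % n)) % n := by
        rw [Nat.mul_mod_mod]; congr 1; ring
      -- apply ih or direct
      have main := ih (2 * a) (2 * e) (fun h => ha (hcop2.dvd_of_dvd_mul_left h))
        (by rw [show 2 * e + (k - 1) * (2 * a) = 2 * (e + (k - 1) * a) by ring]
            exact Dvd.dvd.mul_left hea 2) (by omega)
      rw [hsq, pow_ne_zero_iff (by norm_num), show (k - 1) * (2 * a) = 2 * ((k - 1) * a) by ring,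
        show k * (2 * a) = 2 * (k * a) by ring, sBin_two_mul _ _ hd, sBin_two_mul _ _ hd,
        sBin_two_mul _ _ hd] at main
      apply main
      rw [if_neg hodd] at hN
      rw [show 2 * ((k - 1) * a) = (k - 1) * (2 * a) by ring, hmod]
      generalize ((k - 1) * a) % n = b at *
      by_cases h : 2 * b < n
      · rw [Nat.mod_eq_of_lt h]
        split_ifs <;> omega
      · have h3 : 2 * b % n = 2 * b - n := by
          rw [Nat.mod_eq_sub_mod (by omega), Nat.mod_eq_of_lt (by omega)]
        rw [h3, if_pos (by omega)]
        omega

/-- rank of a group matrix of the multiplicative group, via its eigenvalues -/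
lemma rank_circ {F : Type*} [Field F] [Fintype F] [DecidableEq F] [CharP F 2]
    (n t : ℕ) (hn : n = Fintype.card F - 1) (hodd : Odd n) (ht : Nat.Coprime t n) (c : Fˣ → F) :
    (Matrix.of fun u v : Fˣ => c (v * u⁻¹)).rank =
      ((Finset.range n).filter fun a => ∑ w : Fˣ, c w * (w : F) ^ ((n - 1) * (t * a)) ≠ 0).card := by
  have hcard : Fintype.card Fˣ = Fintype.card (Fin n) := by
    rw [Fintype.card_units, Fintype.card_fin, hn]
  let σ : Fˣ ≃ Fin n := Fintype.equivOfCardEq hcard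
  have hn0 : 0 < n := hodd.pos
  let lam : ℕ → F := fun a => ∑ w : Fˣ, c w * (w : F) ^ ((n - 1) * (t * a))
  let X : Matrix Fˣ Fˣ F := Matrix.of fun u w => (u : F) ^ ((n - 1) * (t * (σ w : ℕ)))
  let Y : Matrix Fˣ Fˣ F := Matrix.of fun w u => (u : F) ^ (t * (σ w : ℕ))
  have hYX : Y * X = 1 := by
    ext i j
    have hs := sum_units_pow (MonoidHom.id F) Function.injective_id
      (t * (σ i : ℕ) + (n - 1) * (t * (σ j : ℕ)))
    rw [← hn] at hs
    simp only [MonoidHom.id_apply] at hs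
    simp only [Matrix.mul_apply, X, Y, Matrix.of_apply, ← pow_add]
    rw [hs, Matrix.one_apply]
    have hn1 : (n : F) = 1 := by
      obtain ⟨m, hm⟩ := hodd
      rw [hm]; push_cast
      rw [CharTwo.two_eq_zero]; simp
    rw [hn1]
    congr 1
    have hj : t * (σ j : ℕ) + (n - 1) * (t * (σ j : ℕ)) = n * (t * (σ j : ℕ)) := by
      obtain ⟨m, rfl⟩ : ∃ m, n = m + 1 := ⟨n - 1, by omega⟩
      simp; ring
    apply propext
    constructor
    · intro h
      have e1 : t * (σ i : ℕ) ≡ t * (σ j : ℕ) [MOD n] := by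
        apply Nat.ModEq.add_right_cancel' ((n - 1) * (t * (σ j : ℕ)))
        rw [hj]
        exact ((Nat.modEq_zero_iff_dvd).2 h).trans
          ((Nat.modEq_zero_iff_dvd).2 (Dvd.intro _ rfl)).symm
      have e2 := Nat.ModEq.cancel_left_of_coprime ht.symm e1
      have e3 := Nat.ModEq.eq_of_lt_of_lt e2 (σ i).2 (σ j).2
      exact σ.injective (Fin.ext e3)
    · rintro rfl
      rw [hj]; exact Dvd.intro _ rfl
  have hMX : (Matrix.of fun u v : Fˣ => c (v * u⁻¹)) * X =
      X * Matrix.diagonal (fun w => lam (σ w)) := by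
    ext u w
    rw [Matrix.mul_diagonal]
    simp only [Matrix.mul_apply, X, Matrix.of_apply, lam]
    rw [Finset.mul_sum]
    refine Fintype.sum_equiv (Equiv.mulRight u⁻¹) _ _ fun v => ?_
    simp only [Equiv.coe_mulRight]
    rw [mul_left_comm ((u : F) ^ _), ← mul_pow (u : F), Units.val_mul, mul_comm (v : F),
      Units.mul_inv_cancel_left]
  have hX : IsUnit X.det := Matrix.isUnit_det_of_left_inverse hYX
  rw [← Matrix.rank_mul_eq_left_of_isUnit_det X _ hX, hMX,
    Matrix.rank_mul_eq_right_of_isUnit_det X _ hX, Matrix.rank_diagonal, Fintype.card_subtype]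
  refine Finset.card_bij (fun w _ => (σ w : ℕ)) ?_ ?_ ?_
  · intro w hw
    simpa [lam] using hw
  · intro w _ w' _ h
    exact σ.injective (Fin.ext h)
  · intro a ha
    simp only [Finset.mem_filter, Finset.mem_range] at ha
    exact ⟨σ.symm ⟨a, ha.1⟩, by simpa [lam] using ha.2, by simp⟩

open scoped Classical in
lemma main_generic {F : Type*} [Field F] [Fintype F] [CharP F 2] (f : ZMod 2 →+* F)
    (d k : ℕ) (hd : 2 ≤ d) (hk : 2 ≤ k) (hF : Fintype.card F = 2 ^ d)
    (h1 : Nat.Coprime k (2 ^ d - 1)) (h2 : Nat.Coprime (k - 1) (2 ^ d - 1))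
    (h2to1 : ∀ y ∈ Finset.univ.image (fun x : F => x + x ^ k),
      (Finset.univ.filter (fun x : F => x + x ^ k = y)).card = 2) :
    (Matrix.of fun u v : Fˣ =>
        if (v * u⁻¹ : Fˣ) ∈ ({u : Fˣ | ∃ x : F, x + x ^ k = (u : F)}ᶜ) then
          (1 : ZMod 2) else 0).rank = B k d := by
  have hq : 4 ≤ 2 ^ d := by
    calc 4 = 2 ^ 2 := by norm_num
      _ ≤ 2 ^ d := Nat.pow_le_pow_right (by norm_num) hd
  have h4 : 4 ∣ 2 ^ d := pow_dvd_pow 2 hd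
  have hodd : Odd (2 ^ d - 1) := by rw [Nat.odd_iff]; omega
  let I := Finset.univ.image (fun x : F => x + x ^ k)
  have hI0 : (0 : F) ∈ I := Finset.mem_image.2 ⟨0, Finset.mem_univ _, by simp; omega⟩
  have hIcard : 2 * I.card = 2 ^ d := by
    have := Finset.card_eq_sum_card_image (fun x : F => x + x ^ k) Finset.univ
    rw [Finset.sum_congr rfl h2to1, Finset.card_univ, hF] at this
    rw [this]
    simp [I, mul_comm]
  let c : Fˣ → F := fun w => if (w : F) ∈ I then 0 else 1
  rw [← rank_map_field f]
  have hM : (Matrix.of fun u v : Fˣ =>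
        if (v * u⁻¹ : Fˣ) ∈ ({u : Fˣ | ∃ x : F, x + x ^ k = (u : F)}ᶜ) then
          (1 : ZMod 2) else 0).map f = Matrix.of fun u v : Fˣ => c (v * u⁻¹) := by
    ext u v
    simp only [Matrix.map_apply, Matrix.of_apply, c, I, Finset.mem_image, Finset.mem_univ,
      true_and, Set.mem_compl_iff, Set.mem_ofPred_eq, ite_not, apply_ite f, map_one, map_zero]
  rw [hM, rank_circ (2 ^ d - 1) (k - 1) (by rw [hF]) hodd h2 c, B]
  -- eigenvalues
  have hlam : ∀ m : ℕ, ∑ w : Fˣ, c w * (w : F) ^ m =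
      ∑ w : Fˣ, (w : F) ^ m + ∑ w : Fˣ, (if (w : F) ∈ I then (w : F) ^ m else 0) := by
    intro m
    rw [← Finset.sum_add_distrib]
    refine Finset.sum_congr rfl fun w _ => ?_
    by_cases h : (w : F) ∈ I
    · simp [c, h, CharTwo.add_self_eq_zero]
    · simp [c, h]
  have hI : ∀ m : ℕ, ∑ y ∈ I, y ^ m =
      0 ^ m + ∑ w : Fˣ, (if (w : F) ∈ I then (w : F) ^ m else 0) := by
    intro m
    have := sum_eq_zero_add_units (fun y : F => if y ∈ I then y ^ m else 0)
    rw [if_pos hI0] at this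
    rw [← this]; simp
  have hunits := fun m => sum_units_pow (MonoidHom.id F) Function.injective_id m
  simp only [MonoidHom.id_apply, hF] at hunits
  congr 1
  ext a
  simp only [Finset.mem_filter, Finset.mem_range, Finset.mem_Ioo]
  rcases Nat.eq_zero_or_pos a with rfl | ha
  · have hc : ((I.card : ℕ) : F) = 0 := by
      rw [CharP.cast_eq_zero_iff F 2]; omega
    have hn1 : ((2 ^ d - 1 : ℕ) : F) = 1 := by
      obtain ⟨m, hm⟩ := hodd
      rw [hm]; push_cast
      rw [CharTwo.two_eq_zero]; simp
    have e1 := hI 0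
    have e2 := hunits 0
    have e3 := hlam 0
    rw [if_pos (dvd_zero _), hn1] at e2
    rw [e2] at e3
    simp only [mul_zero, lt_irrefl, false_and, iff_false, not_and, not_not]
    intro _
    rw [e3]
    simp only [pow_zero, Finset.sum_const, nsmul_eq_mul, mul_one, hc] at e1
    simp only [pow_zero]
    exact e1.symm
  · by_cases han : a < 2 ^ d - 1
    swap
    · simp [han]
    simp only [han, ha, true_and]
    have hna : ¬ (2 ^ d - 1) ∣ a := Nat.not_dvd_of_pos_of_lt ha han
    have hta : ¬ (2 ^ d - 1) ∣ (k - 1) * a := fun h => hna (h2.symm.dvd_of_dvd_mul_left h)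
    have hsum : (2 ^ d - 1 - 1) * ((k - 1) * a) + (k - 1) * a = (2 ^ d - 1) * ((k - 1) * a) := by
      obtain ⟨m, hm⟩ : ∃ m, 2 ^ d - 1 = m + 1 := ⟨2 ^ d - 1 - 1, by omega⟩
      rw [hm]; simp; ring
    have hdiv : (2 ^ d - 1) ∣ (2 ^ d - 1 - 1) * ((k - 1) * a) + (k - 1) * a := by
      rw [hsum]; exact Dvd.intro _ rfl
    have he0 : 0 < (2 ^ d - 1 - 1) * ((k - 1) * a) :=
      Nat.mul_pos (by omega) (Nat.mul_pos (by omega) ha)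
    have hne : ¬ (2 ^ d - 1) ∣ (2 ^ d - 1 - 1) * ((k - 1) * a) := by
      intro h; exact hta ((Nat.dvd_add_right h).1 hdiv)
    rw [← pointwise d k hd hk hF h1 h2 h2to1 _ a _ hna hdiv he0 le_rfl]
    have e1 := hI ((2 ^ d - 1 - 1) * ((k - 1) * a))
    rw [zero_pow he0.ne', zero_add] at e1
    rw [hlam, hunits, if_neg hne, zero_add, ← e1]

open scoped Classical in
/-- The 2-rank of the complement of `D_{k,d} = τ(F_{2^d}) \ {0}`, where `τ(x) = x + x^k`
is two-to-one, equals `B k d`. -/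
theorem stmt_5 (d k : ℕ) (hd : 2 ≤ d) (hk : 2 ≤ k)
    (h1 : Nat.Coprime k (2 ^ d - 1)) (h2 : Nat.Coprime (k - 1) (2 ^ d - 1))
    (h2to1 : ∀ y : GaloisField 2 d, (∃ x, x + x ^ k = y) →
      Nat.card {x : GaloisField 2 d // x + x ^ k = y} = 2) :
    matRank (ZMod 2)
      (Matrix.of fun u v : (GaloisField 2 d)ˣ =>
        if (v * u⁻¹ : (GaloisField 2 d)ˣ) ∈
            ({u : (GaloisField 2 d)ˣ |
                ∃ x : GaloisField 2 d, x + x ^ k = (u : GaloisField 2 d)}ᶜ) then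
          (1 : ZMod 2) else 0) = B k d := by
  let _ : Fintype (GaloisField 2 d) := Fintype.ofFinite _
  have hF : Fintype.card (GaloisField 2 d) = 2 ^ d := by
    rw [← Nat.card_eq_fintype_card, GaloisField.card 2 d (by omega)]
  have key := main_generic (algebraMap (ZMod 2) (GaloisField 2 d)) d k hd hk hF h1 h2 (by
    intro y hy
    obtain ⟨x, -, hx⟩ := Finset.mem_image.1 hy
    have := h2to1 y ⟨x, hx⟩
    rwa [Nat.card_eq_fintype_card, Fintype.card_subtype] at this)
  rw [← key, matRank]
  congr!
end

section
/- For every integer m ≥ 1, B_6(2m) = 2m(F_m − 1) and B_6(2m+1) = (2m+1)(2F_m − 1), where F_n is the n-th Fibonacci number with F₀ = F₁ = 1. Equivalently, the quantity A_6(d) = B_6(d)/d satisfies A_6(2) = 0, A_6(3) = 1, A_6(4) = 1, A_6(5) = 3, and the recurrence A_6(d) = A_6(d−2) + A_6(d−4) + 1 for all d ≥ 6. -/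
/-- Fibonacci numbers normalized so that `F 0 = F 1 = 1`. -/
def Fib' (n : ℕ) : ℕ := Nat.fib (n + 1)

/-- `A6 d = B 6 d / d` as a rational number. -/
noncomputable def A6 (d : ℕ) : ℚ := (B 6 d : ℚ) / d


namespace Six

/-- cyclic right rotation (halving modulo `N`) -/
def hf (N a : ℕ) : ℕ := if a % 2 = 0 then a / 2 else (a + N) / 2

lemma two_hf {N : ℕ} (hN : N % 2 = 1) (a : ℕ) : 2 * hf N a = a + N * (a % 2) := by
  unfold hf
  rcases Nat.mod_two_eq_zero_or_one a with h | h <;> simp only [h] <;> simp <;> omega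

lemma hf_le {N : ℕ} (hN : N % 2 = 1) {a : ℕ} (ha : a ≤ N) : hf N a ≤ N := by
  unfold hf; split_ifs <;> omega

lemma hf_lt {N : ℕ} (hN : N % 2 = 1) {a : ℕ} (ha : a < N) : hf N a < N := by
  unfold hf; split_ifs <;> omega

lemma hf_pos {N : ℕ} (hN : N % 2 = 1) {a : ℕ} (ha : 0 < a) : 0 < hf N a := by
  unfold hf; split_ifs <;> omega

lemma it_lt {N : ℕ} (hN : N % 2 = 1) {a : ℕ} (ha : a < N) (i : ℕ) : (hf N)^[i] a < N := by
  induction i with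
  | zero => simpa
  | succ i ih => rw [Function.iterate_succ_apply']; exact hf_lt hN ih

lemma it_le {N : ℕ} (hN : N % 2 = 1) {a : ℕ} (ha : a ≤ N) (i : ℕ) : (hf N)^[i] a ≤ N := by
  induction i with
  | zero => simpa
  | succ i ih => rw [Function.iterate_succ_apply']; exact hf_le hN ih

lemma it_pos {N : ℕ} (hN : N % 2 = 1) {a : ℕ} (ha : 0 < a) (i : ℕ) : 0 < (hf N)^[i] a := by
  induction i with
  | zero => simpa
  | succ i ih => rw [Function.iterate_succ_apply']; exact hf_pos hN ih

lemma odd_N {d : ℕ} (hd : 1 ≤ d) : (2 ^ d - 1) % 2 = 1 := by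
  obtain ⟨e, rfl⟩ := Nat.exists_eq_add_of_le' hd
  have := Nat.one_le_two_pow (n := e)
  rw [pow_succ]; omega

lemma it_formula {d : ℕ} (hd : 1 ≤ d) (a : ℕ) (i : ℕ) (hi : i ≤ d) :
    (hf (2 ^ d - 1))^[i] a = a / 2 ^ i + (a % 2 ^ i) * 2 ^ (d - i) := by
  induction i with
  | zero => simp [Nat.mod_one]
  | succ i ih =>
    have h1 := two_hf (odd_N hd) ((hf (2 ^ d - 1))^[i] a)
    rw [Function.iterate_succ_apply']
    rw [ih (by omega)] at h1 ⊢
    obtain ⟨e, rfl⟩ : ∃ e, d = i + 1 + e := ⟨d - (i + 1), by omega⟩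
    rw [show i + 1 + e - i = e + 1 by omega] at h1 ⊢
    rw [show i + 1 + e - (i + 1) = e by omega]
    have h2 : (a / 2 ^ i + a % 2 ^ i * 2 ^ (e + 1)) % 2 = a / 2 ^ i % 2 := by
      rw [pow_succ, ← mul_assoc]; omega
    rw [h2] at h1
    have h3 : a / 2 ^ (i + 1) = a / 2 ^ i / 2 := by rw [pow_succ, Nat.div_div_eq_div_mul]
    have h4 : a % 2 ^ (i + 1) = a % 2 ^ i + 2 ^ i * (a / 2 ^ i % 2) := by
      rw [pow_succ, Nat.mod_mul]
    rw [h3, h4]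
    have h5 : 1 ≤ 2 ^ (i + 1 + e) := Nat.one_le_two_pow
    obtain ⟨M, hM⟩ := Nat.exists_eq_add_of_le' h5
    rw [hM] at h1 ⊢
    simp only [Nat.add_sub_cancel] at h1 ⊢
    have h6 : 2 ^ i * 2 ^ e * 2 = M + 1 := by rw [← hM]; ring
    generalize a / 2 ^ i = q at *
    generalize a % 2 ^ i = r at *
    have h7 := Nat.div_add_mod q 2
    have hpe : (2:ℕ) ^ (e + 1) = 2 * 2 ^ e := by ring
    rw [hpe] at h1 ⊢
    generalize (2:ℕ) ^ e = E at *
    generalize (2:ℕ) ^ i = I at *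
    generalize q / 2 = u at *
    generalize q % 2 = v at *
    have : 2 * (u + (r + I * v) * E) = q + r * (2 * E) + M * v := by
      have : 2 * (u + (r + I * v) * E) = 2 * u + r * (2 * E) + (I * E * 2) * v := by ring
      rw [this, h6, ← h7]; ring
    omega

lemma it_d {d : ℕ} (hd : 1 ≤ d) {a : ℕ} (ha : a < 2 ^ d) : (hf (2 ^ d - 1))^[d] a = a := by
  rw [it_formula hd a d le_rfl, Nat.div_eq_of_lt ha, Nat.mod_eq_of_lt ha]; simp

lemma it_bit {d : ℕ} (hd : 1 ≤ d) (a : ℕ) (i : ℕ) (hi : i < d) :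
    (hf (2 ^ d - 1))^[i] a % 2 = a / 2 ^ i % 2 := by
  rw [it_formula hd a i hi.le]
  obtain ⟨e, rfl⟩ : ∃ e, d = i + 1 + e := ⟨d - (i + 1), by omega⟩
  rw [show i + 1 + e - i = e + 1 by omega, pow_succ, ← mul_assoc]; omega

lemma count_eq (d : ℕ) : ∀ y < 2 ^ d,
    (Nat.digits 2 y).count 1 = ∑ i ∈ Finset.range d, y / 2 ^ i % 2 := by
  induction d with
  | zero => intro y hy; have : y = 0 := by simpa using hy
            subst this; simp
  | succ d ih =>
    intro y hy
    rw [Finset.sum_range_succ']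
    rcases Nat.eq_zero_or_pos y with rfl | hp
    · simp
    · rw [Nat.digits_def' (by norm_num) hp, List.count_cons, ih (y / 2) (by rw [pow_succ] at hy; omega)]
      congr 1
      · apply Finset.sum_congr rfl
        intro i _
        rw [Nat.div_div_eq_div_mul, pow_succ, mul_comm]
      · rcases Nat.mod_two_eq_zero_or_one y with h | h <;> simp [h]

lemma sum_it {d : ℕ} (hd : 1 ≤ d) {y : ℕ} (hy : y < 2 ^ d - 1) :
    ∑ i ∈ Finset.range d, (hf (2 ^ d - 1))^[i] y = (2 ^ d - 1) * sBin d y := by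
  have hy' : y < 2 ^ d := by omega
  unfold sBin
  rw [Nat.mod_eq_of_lt hy, count_eq d y hy']
  have h1 : ∑ i ∈ Finset.range d, 2 * (hf (2 ^ d - 1))^[i+1] y
      = ∑ i ∈ Finset.range d, ((hf (2 ^ d - 1))^[i] y + (2 ^ d - 1) * (y / 2 ^ i % 2)) := by
    apply Finset.sum_congr rfl
    intro i hi
    rw [Function.iterate_succ_apply', two_hf (odd_N hd), it_bit hd y i (Finset.mem_range.1 hi)]
  rw [Finset.sum_add_distrib, ← Finset.mul_sum, ← Finset.mul_sum] at h1
  have h2 := Finset.sum_range_succ (fun i => (hf (2 ^ d - 1))^[i] y) d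
  rw [Finset.sum_range_succ'] at h2
  simp only [it_d hd hy', Function.iterate_zero, id] at h2
  omega

lemma hf_mul {N : ℕ} (hN : N % 2 = 1) (c a : ℕ) : hf N (c * a % N) = c * hf N a % N := by
  have hpos : 0 < N := by omega
  have h1 : hf N (c * a % N) < N := hf_lt hN (Nat.mod_lt _ hpos)
  have h2 : c * hf N a % N < N := Nat.mod_lt _ hpos
  have : 2 * hf N (c * a % N) ≡ 2 * (c * hf N a % N) [MOD N] := by
    rw [two_hf hN]
    have e1 : 2 * (c * hf N a % N) ≡ 2 * (c * hf N a) [MOD N] := (Nat.mod_modEq _ _).mul_left 2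
    have e2 : 2 * (c * hf N a) = c * a + N * (c * (a % 2)) := by
      rw [mul_left_comm, two_hf hN]; ring
    rw [e2] at e1
    refine Nat.ModEq.trans ?_ e1.symm
    simp [Nat.ModEq]
  have hc : Nat.gcd N 2 = 1 := by
    rw [Nat.gcd_comm, ← Nat.coprime_iff_gcd_eq_one, Nat.coprime_two_left]; exact Nat.odd_iff.2 hN
  have := Nat.ModEq.cancel_left_of_coprime hc this
  exact Nat.ModEq.eq_of_lt_of_lt this h1 h2

lemma it_mul {N : ℕ} (hN : N % 2 = 1) (c a i : ℕ) :
    (hf N)^[i] (c * a % N) = c * (hf N)^[i] a % N := by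
  induction i with
  | zero => simp
  | succ i ih => rw [Function.iterate_succ_apply', ih, hf_mul hN, Function.iterate_succ_apply']

/-- carry predicate -/
def inS (N r : ℕ) : Prop := N ≤ r + 5 * r % N

instance (N r : ℕ) : Decidable (inS N r) := by unfold inS; infer_instance

lemma carry {N r : ℕ} (hr : r < N) :
    r + 5 * r % N = 6 * r % N + N * (if inS N r then 1 else 0) := by
  have hpos : 0 < N := by omega
  have h : 6 * r % N = (r + 5 * r % N) % N := by
    rw [Nat.add_mod_mod]; congr 1; ring
  have h5 := Nat.mod_lt (5 * r) hpos
  rw [h]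
  by_cases h0 : inS N r
  · rw [if_pos h0]
    unfold inS at h0
    rw [Nat.mod_eq_sub_mod h0, Nat.mod_eq_of_lt (a := r + 5 * r % N - N) (by omega)]; omega
  · rw [if_neg h0]
    unfold inS at h0
    rw [Nat.mod_eq_of_lt (a := r + 5 * r % N) (by omega)]; omega

lemma sBin_mod (d x : ℕ) : sBin d (x % (2 ^ d - 1)) = sBin d x := by
  unfold sBin; rw [Nat.mod_mod]

lemma key {d : ℕ} (hd : 1 ≤ d) {a : ℕ} (ha : a < 2 ^ d - 1) :
    sBin d a + sBin d (5 * a) = sBin d (6 * a) +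
      ((Finset.range d).filter (fun i => inS (2 ^ d - 1) ((hf (2 ^ d - 1))^[i] a))).card := by
  have hN := odd_N hd
  have hpos : 0 < 2 ^ d - 1 := by omega
  have e5 := sum_it hd (Nat.mod_lt (5 * a) hpos)
  have e6 := sum_it hd (Nat.mod_lt (6 * a) hpos)
  have e1 := sum_it hd ha
  rw [sBin_mod] at e5 e6
  simp only [it_mul hN] at e5 e6
  apply Nat.eq_of_mul_eq_mul_left hpos
  rw [mul_add, mul_add, ← e1, ← e5, ← e6, ← Finset.sum_add_distrib, Finset.card_filter,
    Finset.mul_sum, ← Finset.sum_add_distrib]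
  apply Finset.sum_congr rfl
  intro i _
  exact carry (it_lt hN ha i)

/-- primitive configurations: carry exactly at position `i` -/
def Cset (d i : ℕ) : Finset ℕ :=
  (Finset.Ioo 0 (2 ^ d - 1)).filter (fun a =>
    (Finset.range d).filter (fun j => inS (2 ^ d - 1) ((hf (2 ^ d - 1))^[j] a)) = {i})

lemma mem_Cset {d i a : ℕ} (hi : i < d) : a ∈ Cset d i ↔ (0 < a ∧ a < 2 ^ d - 1) ∧
    ∀ j < d, (inS (2 ^ d - 1) ((hf (2 ^ d - 1))^[j] a) ↔ j = i) := by
  unfold Cset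
  rw [Finset.mem_filter, Finset.mem_Ioo]
  refine and_congr_right fun _ => ?_
  rw [Finset.ext_iff]
  simp only [Finset.mem_filter, Finset.mem_range, Finset.mem_singleton]
  constructor
  · intro h j hj; rw [← h j]; tauto
  · intro h j
    constructor
    · rintro ⟨h1, h2⟩; exact (h j h1).1 h2
    · rintro rfl; exact ⟨hi, (h j hi).2 rfl⟩

lemma B_eq_sum {d : ℕ} (hd : 1 ≤ d) : B 6 d = ∑ i ∈ Finset.range d, (Cset d i).card := by
  unfold B
  rw [← Finset.card_biUnion]
  · congr 1
    ext a
    simp only [Finset.mem_filter, Finset.mem_biUnion, Finset.mem_range, Cset]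
    constructor
    · rintro ⟨h1, h2⟩
      have := key hd (Finset.mem_Ioo.1 h1).2
      have hc : ((Finset.range d).filter
        (fun i => inS (2 ^ d - 1) ((hf (2 ^ d - 1))^[i] a))).card = 1 := by
        simp only [show 6 - 1 = 5 from rfl] at h2; omega
      obtain ⟨i, hi⟩ := Finset.card_eq_one.1 hc
      refine ⟨i, ?_, h1, hi⟩
      have : i ∈ (Finset.range d).filter
        (fun i => inS (2 ^ d - 1) ((hf (2 ^ d - 1))^[i] a)) := by rw [hi]; simp
      exact Finset.mem_range.1 (Finset.mem_filter.1 this).1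
    · rintro ⟨i, hi, h1, h2⟩
      refine ⟨h1, ?_⟩
      have := key hd (Finset.mem_Ioo.1 h1).2
      rw [h2] at this
      simpa using this
  · intro i _ j _ hij
    rw [Function.onFun, Finset.disjoint_left]
    intro a h1 h2
    have h1 := (Finset.mem_filter.1 h1).2
    have h2 := (Finset.mem_filter.1 h2).2
    rw [h1] at h2
    exact hij (Finset.singleton_injective h2)

lemma it_modd {d : ℕ} (hd : 1 ≤ d) {a : ℕ} (ha : a < 2 ^ d) (m : ℕ) :
    (hf (2 ^ d - 1))^[m] a = (hf (2 ^ d - 1))^[m % d] a :=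
  (Function.IsPeriodicPt.iterate_mod_apply (it_d hd ha) m).symm

lemma Cset_card {d i : ℕ} (hd : 1 ≤ d) (hi : i < d) : (Cset d i).card = (Cset d 0).card := by
  have hN := odd_N hd
  apply Finset.card_nbij' (i := (hf (2 ^ d - 1))^[i]) (j := (hf (2 ^ d - 1))^[d - i])
  · intro a ha
    rw [Finset.mem_coe, mem_Cset hi] at ha
    rw [Finset.mem_coe, mem_Cset (by omega)]
    obtain ⟨⟨h1, h2⟩, h3⟩ := ha
    refine ⟨⟨it_pos hN h1 _, it_lt hN h2 _⟩, fun j hj => ?_⟩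
    rw [← Function.iterate_add_apply, it_modd hd (by omega), h3 _ (Nat.mod_lt _ (by omega))]
    rcases lt_or_ge (j + i) d with h | h
    · rw [Nat.mod_eq_of_lt h]; omega
    · rw [Nat.mod_eq_sub_mod h, Nat.mod_eq_of_lt (by omega)]; omega
  · intro a ha
    rw [Finset.mem_coe, mem_Cset (by omega)] at ha
    rw [Finset.mem_coe, mem_Cset hi]
    obtain ⟨⟨h1, h2⟩, h3⟩ := ha
    refine ⟨⟨it_pos hN h1 _, it_lt hN h2 _⟩, fun j hj => ?_⟩
    rw [← Function.iterate_add_apply, it_modd hd (by omega), h3 _ (Nat.mod_lt _ (by omega))]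
    rcases lt_or_ge (j + (d - i)) d with h | h
    · rw [Nat.mod_eq_of_lt h]; omega
    · rw [Nat.mod_eq_sub_mod h, Nat.mod_eq_of_lt (by omega)]; omega
  · intro a ha
    rw [Finset.mem_coe, mem_Cset hi] at ha
    rw [← Function.iterate_add_apply, show d - i + i = d by omega]
    exact it_d hd (by omega)
  · intro a ha
    rw [Finset.mem_coe, mem_Cset (by omega)] at ha
    rw [← Function.iterate_add_apply, show i + (d - i) = d by omega]
    exact it_d hd (by omega)

lemma B_eq {d : ℕ} (hd : 1 ≤ d) : B 6 d = d * (Cset d 0).card := by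
  rw [B_eq_sum hd, Finset.sum_congr rfl (fun i hi => Cset_card hd (Finset.mem_range.1 hi))]
  simp

/-- interval class of `a / N` -/
def cls (N a : ℕ) : Fin 10 :=
  if 6 * a < N then 0 else if 5 * a < N then 1 else if 3 * a < N then 2
  else if 5 * a < 2 * N then 3 else if 2 * a < N then 4 else if 5 * a < 3 * N then 5
  else if 3 * a < 2 * N then 6 else if 5 * a < 4 * N then 7 else if 6 * a < 5 * N then 8 else 9

/-- transitions for prepending a bit -/
def step (k : Fin 10) (b : ℕ) : Fin 10 :=
  if b = 0 then ![0,0,0,1,2,2,2,3,4,4] k else ![5,5,6,7,7,7,8,9,9,9] k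

lemma cls_cases (N a : ℕ) :
    (30 * a < 5 * N ∧ cls N a = 0) ∨ (5 * N ≤ 30 * a ∧ 30 * a < 6 * N ∧ cls N a = 1) ∨
    (6 * N ≤ 30 * a ∧ 30 * a < 10 * N ∧ cls N a = 2) ∨
    (10 * N ≤ 30 * a ∧ 30 * a < 12 * N ∧ cls N a = 3) ∨
    (12 * N ≤ 30 * a ∧ 30 * a < 15 * N ∧ cls N a = 4) ∨
    (15 * N ≤ 30 * a ∧ 30 * a < 18 * N ∧ cls N a = 5) ∨
    (18 * N ≤ 30 * a ∧ 30 * a < 20 * N ∧ cls N a = 6) ∨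
    (20 * N ≤ 30 * a ∧ 30 * a < 24 * N ∧ cls N a = 7) ∨
    (24 * N ≤ 30 * a ∧ 30 * a < 25 * N ∧ cls N a = 8) ∨ (25 * N ≤ 30 * a ∧ cls N a = 9) := by
  unfold cls
  by_cases h0 : 6 * a < N
  · rw [if_pos h0]; left; exact ⟨by omega, rfl⟩
  rw [if_neg h0]; right
  by_cases h1 : 5 * a < N
  · rw [if_pos h1]; left; exact ⟨by omega, by omega, rfl⟩
  rw [if_neg h1]; right
  by_cases h2 : 3 * a < N
  · rw [if_pos h2]; left; exact ⟨by omega, by omega, rfl⟩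
  rw [if_neg h2]; right
  by_cases h3 : 5 * a < 2 * N
  · rw [if_pos h3]; left; exact ⟨by omega, by omega, rfl⟩
  rw [if_neg h3]; right
  by_cases h4 : 2 * a < N
  · rw [if_pos h4]; left; exact ⟨by omega, by omega, rfl⟩
  rw [if_neg h4]; right
  by_cases h5 : 5 * a < 3 * N
  · rw [if_pos h5]; left; exact ⟨by omega, by omega, rfl⟩
  rw [if_neg h5]; right
  by_cases h6 : 3 * a < 2 * N
  · rw [if_pos h6]; left; exact ⟨by omega, by omega, rfl⟩
  rw [if_neg h6]; right
  by_cases h7 : 5 * a < 4 * N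
  · rw [if_pos h7]; left; exact ⟨by omega, by omega, rfl⟩
  rw [if_neg h7]; right
  by_cases h8 : 6 * a < 5 * N
  · rw [if_pos h8]; left; exact ⟨by omega, by omega, rfl⟩
  rw [if_neg h8]; right
  exact ⟨by omega, rfl⟩

set_option maxHeartbeats 4000000 in
lemma cls_hf {N : ℕ} (hN : N % 2 = 1) {a : ℕ} (ha : a ≤ N) :
    cls N (hf N a) = step (cls N a) (a % 2) := by
  have h2 := two_hf hN a
  generalize hf N a = x at *
  rcases Nat.mod_two_eq_zero_or_one a with h | h <;> rw [h] at h2 ⊢ <;>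
  · simp only [mul_zero, mul_one, add_zero] at h2
    rcases cls_cases N a with c | c | c | c | c | c | c | c | c | c <;>
    rcases cls_cases N x with e | e | e | e | e | e | e | e | e | e <;>
    first
    | (exfalso; omega)
    | (simp only [c, e]; decide)

set_option maxHeartbeats 4000000 in
lemma inS_cls {N a : ℕ} (ha : a < N) : inS N a ↔ (cls N a).val % 2 = 1 := by
  have hq : 5 * a / N < 5 := by rw [Nat.div_lt_iff_lt_mul (by omega)]; omega
  have hm := Nat.div_add_mod (5 * a) N
  have hl := Nat.mod_lt (5 * a) (show 0 < N by omega)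
  unfold inS
  generalize 5 * a % N = r at *
  generalize 5 * a / N = q at *
  rcases cls_cases N a with c | c | c | c | c | c | c | c | c | c <;>
  interval_cases q <;>
  first
  | (exfalso; omega)
  | (simp only [c]; constructor <;> intro h0 <;> first | decide | omega |
      (exact absurd h0 (by decide)))

/-- all states visited before the end are carry free, and the last one is `t` -/
def Path (t : Fin 10) : Fin 10 → ℕ → ℕ → Prop
  | k, 0, _ => k = t
  | k, n + 1, w => k.val % 2 = 0 ∧ Path t (step k (w % 2)) n (w / 2)

/-- final state -/
def run : Fin 10 → ℕ → ℕ → Fin 10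
  | k, 0, _ => k
  | k, n + 1, w => run (step k (w % 2)) n (w / 2)

instance decPath (t : Fin 10) : ∀ (k : Fin 10) (n w : ℕ), Decidable (Path t k n w)
  | k, 0, _ => by unfold Path; infer_instance
  | k, n + 1, w => by
    unfold Path
    have := decPath t (step k (w % 2)) n (w / 2)
    infer_instance

lemma cls_it_succ {d : ℕ} (hd : 1 ≤ d) {a : ℕ} (ha : a < 2 ^ d) {j : ℕ} (hj : j < d) :
    cls (2 ^ d - 1) ((hf (2 ^ d - 1))^[j + 1] a) =
      step (cls (2 ^ d - 1) ((hf (2 ^ d - 1))^[j] a)) (a / 2 ^ j % 2) := by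
  rw [Function.iterate_succ_apply', cls_hf (odd_N hd) (it_le (odd_N hd) (by omega) j),
    it_bit hd a j hj]

lemma run_eq {d : ℕ} (hd : 1 ≤ d) {a : ℕ} (ha : a < 2 ^ d) (n : ℕ) : ∀ j, j + n = d →
    run (cls (2 ^ d - 1) ((hf (2 ^ d - 1))^[j] a)) n (a / 2 ^ j) = cls (2 ^ d - 1) a := by
  induction n with
  | zero => rintro j rfl; simp only [add_zero] at *; rw [run, it_d hd ha]
  | succ n ih =>
    intro j hj
    rw [run, ← cls_it_succ hd ha (by omega), Nat.div_div_eq_div_mul, ← pow_succ]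
    exact ih (j + 1) (by omega)

lemma path_iff {d : ℕ} (hd : 1 ≤ d) {a : ℕ} (ha : a < 2 ^ d) (t : Fin 10) (n : ℕ) :
    ∀ j, j + n = d →
    (Path t (cls (2 ^ d - 1) ((hf (2 ^ d - 1))^[j] a)) n (a / 2 ^ j) ↔
      (∀ i, j ≤ i → i < d → (cls (2 ^ d - 1) ((hf (2 ^ d - 1))^[i] a)).val % 2 = 0) ∧
        cls (2 ^ d - 1) a = t) := by
  induction n with
  | zero =>
    rintro j rfl
    simp only [add_zero] at *
    rw [Path, it_d hd ha]
    constructor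
    · intro h; exact ⟨fun i h1 h2 => by omega, h⟩
    · exact fun h => h.2
  | succ n ih =>
    intro j hj
    rw [Path, ← cls_it_succ hd ha (by omega), Nat.div_div_eq_div_mul, ← pow_succ,
      ih (j + 1) (by omega), ← and_assoc]
    refine and_congr_left fun _ => ?_
    constructor
    · rintro ⟨h1, h2⟩ i hi hi'
      rcases Nat.eq_or_lt_of_le hi with rfl | h
      · exact h1
      · exact h2 i h hi'
    · intro h
      exact ⟨h j le_rfl (by omega), fun i h1 h2 => h i (by omega) h2⟩

lemma mem_C0 {n a : ℕ} : a ∈ Cset (n + 1) 0 ↔ (0 < a ∧ a < 2 ^ (n + 1) - 1) ∧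
    (cls (2 ^ (n + 1) - 1) a).val % 2 = 1 ∧
    Path (cls (2 ^ (n + 1) - 1) a) (step (cls (2 ^ (n + 1) - 1) a) (a % 2)) n (a / 2) := by
  rw [mem_Cset (by omega)]
  refine and_congr_right fun ⟨h1, h2⟩ => ?_
  have hd : 1 ≤ n + 1 := by omega
  have ha : a < 2 ^ (n + 1) := by omega
  have hp := path_iff hd ha (cls (2 ^ (n + 1) - 1) a) n 1 (by omega)
  rw [show (1:ℕ) = 0 + 1 from rfl, cls_it_succ hd ha (by omega)] at hp
  simp only [Function.iterate_zero, id, pow_zero, Nat.div_one, zero_add, pow_one, and_true] at hp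
  rw [hp]
  constructor
  · intro h
    refine ⟨(inS_cls h2).1 ((h 0 (by omega)).2 rfl), fun i hi hi' => ?_⟩
    have := (h i hi').not.2 (by omega)
    rw [inS_cls (it_lt (odd_N hd) h2 i)] at this
    omega
  · rintro ⟨h3, h4⟩ j hj
    rw [inS_cls (it_lt (odd_N hd) h2 j)]
    rcases Nat.eq_zero_or_pos j with rfl | hj0
    · simpa using h3
    · have := h4 j hj0 hj
      omega

/-! ### synchronisation -/

/-- pair invariant for target 5 -/
def Inv5 (k k' : Fin 10) : Prop :=
  (k = 0 → k' ≤ 2) ∧ (k = 2 → k' ≤ 6) ∧ (k = 5 → k' = 5 ∨ k' = 6)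

instance (k k' : Fin 10) : Decidable (Inv5 k k') := by unfold Inv5; infer_instance

/-- pair invariant for target 9 -/
def Inv9 (k k' : Fin 10) : Prop :=
  (k = 6 → 3 ≤ k') ∧ (k = 8 → 7 ≤ k') ∧ (k = 9 → k' = 9)

instance (k k' : Fin 10) : Decidable (Inv9 k k') := by unfold Inv9; infer_instance

lemma inv5_step : ∀ k k' : Fin 10, ∀ b : Fin 2, k.val % 2 = 0 → Inv5 k k' →
    Inv5 (step k b.val) (step k' b.val) := by decide

lemma inv9_step : ∀ k k' : Fin 10, ∀ b : Fin 2, k.val % 2 = 0 → Inv9 k k' →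
    Inv9 (step k b.val) (step k' b.val) := by decide

lemma sync5 (n : ℕ) : ∀ k k' w, Inv5 k k' → Path 5 k n w → run k' n w = 5 ∨ run k' n w = 6 := by
  induction n with
  | zero => intro k k' w h hp; exact h.2.2 hp
  | succ n ih =>
    intro k k' w h hp
    exact ih _ _ _ (inv5_step k k' ⟨w % 2, Nat.mod_lt _ (by norm_num)⟩ hp.1 h) hp.2

lemma sync9 (n : ℕ) : ∀ k k' w, Inv9 k k' → Path 9 k n w → run k' n w = 9 := by
  induction n with
  | zero => intro k k' w h hp; exact h.2.2 hp
  | succ n ih =>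
    intro k k' w h hp
    exact ih _ _ _ (inv9_step k k' ⟨w % 2, Nat.mod_lt _ (by norm_num)⟩ hp.1 h) hp.2

lemma path_run (t : Fin 10) (n : ℕ) : ∀ k w, Path t k n w → run k n w = t := by
  induction n with
  | zero => intro k w h; exact h
  | succ n ih => intro k w h; exact ih _ _ h.2

lemma no_path1 (n : ℕ) : ∀ k w, (k = 0 ∨ k = 5) → ¬ Path 1 k n w := by
  induction n with
  | zero => rintro k w (rfl | rfl) h <;> rw [Path] at h <;> exact absurd h (by decide)
  | succ n ih =>
    rintro k w (rfl | rfl) h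
    · refine ih _ _ ?_ h.2
      rcases Nat.mod_two_eq_zero_or_one w with e | e <;> rw [e] <;> decide
    · exact absurd h.1 (by decide)

lemma no_path_odd (t k : Fin 10) (hk : k.val % 2 = 1) (ht : k ≠ t) (n w : ℕ) : ¬ Path t k n w := by
  cases n with
  | zero => exact ht
  | succ n => intro h; have := h.1; omega

/-- loops at `t` -/
def W (t : Fin 10) (n : ℕ) : Finset ℕ :=
  (Finset.range (2 ^ (n + 1))).filter (fun w => Path t (step t (w % 2)) n (w / 2))

lemma cls_loop {n w : ℕ} (hw : w < 2 ^ (n + 1)) :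
    run (step (cls (2 ^ (n + 1) - 1) w) (w % 2)) n (w / 2) = cls (2 ^ (n + 1) - 1) w := by
  have := run_eq (d := n + 1) (by omega) hw (n + 1) 0 (by omega)
  simpa [run] using this

lemma W5_cls {n w : ℕ} (hw : w ∈ W 5 n) : cls (2 ^ (n + 1) - 1) w = 5 := by
  obtain ⟨h1, h2⟩ := Finset.mem_filter.1 hw
  have h1 := Finset.mem_range.1 h1
  have hl := cls_loop h1
  rcases Nat.mod_two_eq_zero_or_one w with e | e <;> rw [e] at h2 hl
  · have hinv : ∀ k, Inv5 (step 5 0) (step k 0) := by decide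
    rcases sync5 n _ _ _ (hinv (cls (2 ^ (n + 1) - 1) w)) h2 with h | h
    · rw [← hl, h]
    · rw [hl] at h
      rw [h] at hl
      have := path_run _ _ _ _ h2
      rw [show step 6 0 = step 5 0 by decide, this] at hl
      exact absurd hl (by decide)
  · exact absurd h2 (no_path_odd _ _ (by decide) (by decide) _ _)

lemma W9_cls {n w : ℕ} (hn : 1 ≤ n) (hw : w ∈ W 9 n) :
    w % 2 = 0 ∧ cls (2 ^ (n + 1) - 1) w = 9 := by
  obtain ⟨h1, h2⟩ := Finset.mem_filter.1 hw
  have h1 := Finset.mem_range.1 h1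
  have hl := cls_loop h1
  rcases Nat.mod_two_eq_zero_or_one w with e | e <;> rw [e] at h2 hl
  · have hinv : ∀ k, Inv9 (step 9 0) (step k 0) := by decide
    refine ⟨e, ?_⟩
    rw [← hl]
    exact sync9 n _ _ _ (hinv (cls (2 ^ (n + 1) - 1) w)) h2
  · obtain ⟨m, rfl⟩ := Nat.exists_eq_add_of_le' hn
    exact absurd h2.1 (by decide)

lemma C0_eq {n : ℕ} (hn : 1 ≤ n) : Cset (n + 1) 0 = W 5 n ∪ W 9 n := by
  ext a
  rw [mem_C0, Finset.mem_union]
  constructor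
  · rintro ⟨⟨h1, h2⟩, h3, h4⟩
    have ha : a ∈ Finset.range (2 ^ (n + 1)) := Finset.mem_range.2 (by omega)
    have hcase : ∀ t : Fin 10, t.val % 2 = 1 → t = 1 ∨ t = 3 ∨ t = 5 ∨ t = 7 ∨ t = 9 := by decide
    unfold W
    simp only [Finset.mem_filter, ha, true_and]
    rcases hcase _ h3 with h | h | h | h | h <;> rw [h] at h4
    · exfalso
      refine no_path1 _ _ _ ?_ h4
      rcases Nat.mod_two_eq_zero_or_one a with e | e <;> rw [e] <;> decide
    · exfalso
      rcases Nat.mod_two_eq_zero_or_one a with e | e <;> rw [e] at h4 <;>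
        exact no_path_odd _ _ (by decide) (by decide) _ _ h4
    · exact Or.inl h4
    · exfalso
      rcases Nat.mod_two_eq_zero_or_one a with e | e <;> rw [e] at h4 <;>
        exact no_path_odd _ _ (by decide) (by decide) _ _ h4
    · exact Or.inr h4
  · have hN := odd_N (d := n + 1) (by omega)
    rintro (h | h)
    · have hc := W5_cls h
      obtain ⟨h1, h2⟩ := Finset.mem_filter.1 h
      have h1 := Finset.mem_range.1 h1
      refine ⟨?_, ?_, ?_⟩
      · constructor
        · rcases Nat.eq_zero_or_pos a with rfl | hp
          · unfold cls at hc; simp at hc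
          · exact hp
        · by_contra hlt
          have : a = 2 ^ (n + 1) - 1 := by omega
          rw [← this] at hc hN
          unfold cls at hc
          split_ifs at hc <;> first | omega | (exact absurd hc (by decide))
      · rw [hc]; decide
      · rw [hc]; exact h2
    · obtain ⟨he, hc⟩ := W9_cls hn h
      obtain ⟨h1, h2⟩ := Finset.mem_filter.1 h
      have h1 := Finset.mem_range.1 h1
      refine ⟨?_, ?_, ?_⟩
      · constructor
        · rcases Nat.eq_zero_or_pos a with rfl | hp
          · unfold cls at hc; simp at hc
          · exact hp
        · omega
      · rw [hc]; decide
      · rw [hc]; exact h2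

/-! ### counting -/

/-- number of paths -/
def cnt (t : Fin 10) : Fin 10 → ℕ → ℕ
  | k, 0 => if k = t then 1 else 0
  | k, n + 1 => if k.val % 2 = 0 then cnt t (step k 0) n + cnt t (step k 1) n else 0

lemma split_card (P : ℕ → ℕ → Prop) [∀ b w, Decidable (P b w)] (n : ℕ) :
    ((Finset.range (2 ^ (n + 1))).filter (fun w => P (w % 2) (w / 2))).card =
      ((Finset.range (2 ^ n)).filter (P 0)).card + ((Finset.range (2 ^ n)).filter (P 1)).card := by
  rw [← Finset.card_filter_add_card_filter_not (fun w => w % 2 = 0)]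
  congr 1
  · apply Finset.card_nbij' (i := fun w => w / 2) (j := fun w => 2 * w)
    · intro a; simp only [Finset.coe_filter, Finset.mem_filter, Finset.mem_range, Set.mem_ofPred_eq]
      rintro ⟨⟨h1, h2⟩, h3⟩
      rw [h3] at h2
      exact ⟨by rw [pow_succ] at h1; omega, h2⟩
    · intro a; simp only [Finset.coe_filter, Finset.mem_filter, Finset.mem_range, Set.mem_ofPred_eq]
      rintro ⟨h1, h2⟩
      rw [show 2 * a % 2 = 0 by omega, show 2 * a / 2 = a by omega]
      exact ⟨⟨by rw [pow_succ]; omega, h2⟩, rfl⟩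
    · intro a; simp only [Finset.coe_filter, Finset.mem_filter, Set.mem_ofPred_eq]
      rintro ⟨_, h3⟩; omega
    · intro a _; simp
  · apply Finset.card_nbij' (i := fun w => w / 2) (j := fun w => 2 * w + 1)
    · intro a; simp only [Finset.coe_filter, Finset.mem_filter, Finset.mem_range, Set.mem_ofPred_eq]
      rintro ⟨⟨h1, h2⟩, h3⟩
      rw [show a % 2 = 1 by omega] at h2
      exact ⟨by rw [pow_succ] at h1; omega, h2⟩
    · intro a; simp only [Finset.coe_filter, Finset.mem_filter, Finset.mem_range, Set.mem_ofPred_eq]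
      rintro ⟨h1, h2⟩
      rw [show (2 * a + 1) % 2 = 1 by omega, show (2 * a + 1) / 2 = a by omega]
      exact ⟨⟨by rw [pow_succ]; omega, h2⟩, by norm_num⟩
    · intro a; simp only [Finset.coe_filter, Finset.mem_filter, Set.mem_ofPred_eq]
      rintro ⟨_, h3⟩; omega
    · intro a _; simp only; omega

lemma card_path (t : Fin 10) (n : ℕ) : ∀ k,
    ((Finset.range (2 ^ n)).filter (Path t k n)).card = cnt t k n := by
  induction n with
  | zero => intro k; simp only [Path, cnt]; split_ifs with h <;> simp [h]
  | succ n ih =>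
    intro k
    simp only [Path, cnt]
    split_ifs with h
    · simp only [h, true_and]
      rw [split_card (fun b w => Path t (step k b) n w), ih, ih]
    · simp [h]

lemma W_card (t : Fin 10) (n : ℕ) : (W t n).card = cnt t (step t 0) n + cnt t (step t 1) n := by
  unfold W
  rw [split_card (fun b w => Path t (step t b) n w), card_path, card_path]

lemma cnt_odd (t k : Fin 10) (hk : k.val % 2 = 1) (n : ℕ) : cnt t k (n + 1) = 0 := by
  rw [cnt, if_neg (by omega)]

lemma cnt5 (m : ℕ) :
    (cnt 5 2 (2 * m) + 1 = Nat.fib (m + 2) ∧ cnt 5 2 (2 * m + 1) + 1 = Nat.fib (m + 2)) ∧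
    (cnt 5 8 (2 * m) + 1 = Nat.fib (m + 1) ∧ cnt 5 8 (2 * m + 1) + 1 = Nat.fib (m + 1)) ∧
    cnt 5 0 (2 * m + 1) = 1 ∧ cnt 5 0 (2 * m + 2) = 1 := by
  have e2 : ∀ n, cnt 5 2 (n + 1) = cnt 5 0 n + cnt 5 6 n := fun n => rfl
  have e6 : ∀ n, cnt 5 6 (n + 1) = cnt 5 2 n + cnt 5 8 n := fun n => rfl
  have e8 : ∀ n, cnt 5 8 (n + 1) = cnt 5 4 n + cnt 5 9 n := fun n => rfl
  have e4 : ∀ n, cnt 5 4 (n + 1) = cnt 5 2 n + cnt 5 7 n := fun n => rfl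
  have e0 : ∀ n, cnt 5 0 (n + 1) = cnt 5 0 n + cnt 5 5 n := fun n => rfl
  have o9 : ∀ n, cnt 5 9 n = 0 := by intro n; cases n <;> rfl
  have o7 : ∀ n, cnt 5 7 n = 0 := by intro n; cases n <;> rfl
  have o5 : ∀ n, cnt 5 5 (n + 1) = 0 := fun n => rfl
  induction m with
  | zero => decide
  | succ m ih =>
    obtain ⟨⟨h1, h2⟩, ⟨h3, h4⟩, h5, h6⟩ := ih
    have f1 : Nat.fib (m + 1 + 2) = Nat.fib (m + 1) + Nat.fib (m + 2) := Nat.fib_add_two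
    rw [show 2 * (m + 1) = 2 * m + 1 + 1 by ring]
    simp only [e2, e6, e8, e4, e0, o9, o7, o5] at *
    refine ⟨⟨?_, ?_⟩, ⟨?_, ?_⟩, ?_, ?_⟩ <;> (try simp only [f1, show m + 1 + 1 = m + 2 from rfl]) <;> omega

lemma cnt9 (m : ℕ) :
    (cnt 9 2 (2 * m) = 0 ∧ cnt 9 2 (2 * m + 1) = Nat.fib m) ∧
    (cnt 9 8 (2 * m + 2) = 0 ∧ cnt 9 8 (2 * m + 3) = Nat.fib m) := by
  have z0 : ∀ n, cnt 9 0 n = 0 := by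
    intro n; induction n with
    | zero => rfl
    | succ n ih =>
      have : cnt 9 0 (n + 1) = cnt 9 0 n + cnt 9 5 n := rfl
      rw [this, ih]; cases n <;> rfl
  have e2 : ∀ n, cnt 9 2 (n + 1) = cnt 9 6 n := fun n => by
    have : cnt 9 2 (n + 1) = cnt 9 0 n + cnt 9 6 n := rfl
    rw [this, z0, zero_add]
  have e6 : ∀ n, cnt 9 6 (n + 1) = cnt 9 2 n + cnt 9 8 n := fun n => rfl
  have o7 : ∀ n, cnt 9 7 n = 0 := by intro n; cases n <;> rfl
  have e4 : ∀ n, cnt 9 4 (n + 1) = cnt 9 2 n := fun n => by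
    have : cnt 9 4 (n + 1) = cnt 9 2 n + cnt 9 7 n := rfl
    rw [this, o7, add_zero]
  have e8 : ∀ n, cnt 9 8 (n + 2) = cnt 9 2 n := fun n => by
    have : cnt 9 8 (n + 2) = cnt 9 4 (n + 1) + cnt 9 9 (n + 1) := rfl
    rw [this, e4]; rfl
  have e22 : ∀ n, cnt 9 2 (n + 2) = cnt 9 2 n + cnt 9 8 n := fun n => by rw [e2, e6]
  have main : ∀ m, (cnt 9 2 (2 * m) = 0 ∧ cnt 9 2 (2 * m + 2) = 0) ∧
      (cnt 9 2 (2 * m + 1) = Nat.fib m ∧ cnt 9 2 (2 * m + 3) = Nat.fib (m + 1)) := by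
    intro m
    induction m with
    | zero => decide
    | succ m ih =>
      obtain ⟨⟨h1, h2⟩, h3, h4⟩ := ih
      refine ⟨⟨h2, ?_⟩, h4, ?_⟩
      · have := e22 (2 * m + 2)
        rw [e8, h1, h2] at this
        exact this
      · have := e22 (2 * m + 3)
        rw [show 2 * m + 3 = (2 * m + 1) + 2 from rfl, e8] at this
        rw [h3, show 2 * m + 1 + 2 = 2 * m + 3 from rfl, h4] at this
        rw [Nat.fib_add_two, add_comm (Nat.fib m)]
        exact this
  refine ⟨⟨(main m).1.1, (main m).2.1⟩, ?_, ?_⟩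
  · rw [e8]; exact (main m).1.1
  · rw [show 2 * m + 3 = (2 * m + 1) + 2 from rfl, e8]; exact (main m).2.1

lemma B_cnt {n : ℕ} (hn : 1 ≤ n) : B 6 (n + 1) = (n + 1) * (cnt 5 2 n + cnt 9 2 (n - 1)) := by
  rw [B_eq (by omega), C0_eq hn, Finset.card_union_of_disjoint, W_card, W_card]
  · obtain ⟨m, rfl⟩ := Nat.exists_eq_add_of_le' hn
    have a1 : cnt 5 (step 5 1) (m + 1) = 0 := cnt_odd _ _ (by decide) _
    have a2 : cnt 9 (step 9 1) (m + 1) = 0 := cnt_odd _ _ (by decide) _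
    have a3 : cnt 9 (step 9 0) (m + 1) = cnt 9 2 m + cnt 9 7 m := rfl
    have a4 : cnt 9 7 m = 0 := by cases m <;> rfl
    rw [a1, a2, a3, a4]; rfl
  · rw [Finset.disjoint_left]
    intro a h1 h2
    have h1 := W5_cls h1
    have h2 := (W9_cls hn h2).2
    rw [h1] at h2
    exact absurd h2 (by decide)

lemma B_even (m : ℕ) (hm : 1 ≤ m) : B 6 (2 * m) = 2 * m * (Fib' m - 1) := by
  obtain ⟨k, rfl⟩ := Nat.exists_eq_add_of_le' hm
  rw [show 2 * (k + 1) = (2 * k + 1) + 1 by ring, B_cnt (by omega)]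
  have h1 := (cnt5 k).1.2
  have h2 := (cnt9 k).1.1
  simp only [Nat.add_sub_cancel, Fib', h2, show k + 1 + 1 = k + 2 from rfl, ← h1, add_zero]

lemma B_odd (m : ℕ) (hm : 1 ≤ m) : B 6 (2 * m + 1) = (2 * m + 1) * (2 * Fib' m - 1) := by
  obtain ⟨k, rfl⟩ := Nat.exists_eq_add_of_le' hm
  rw [B_cnt (by omega)]
  have h1 := (cnt5 (k + 1)).1.1
  have h2 := (cnt9 k).1.2
  rw [show 2 * (k + 1) - 1 = 2 * k + 1 by omega, h2]
  have f1 : Nat.fib (k + 1 + 2) = Nat.fib (k + 1) + Nat.fib (k + 2) := Nat.fib_add_two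
  have f2 : Nat.fib (k + 2) = Nat.fib k + Nat.fib (k + 1) := Nat.fib_add_two
  congr 1
  simp only [Fib', show k + 1 + 1 = k + 2 from rfl]
  omega

lemma Fib'_pos (m : ℕ) : 1 ≤ Fib' m := Nat.fib_pos.2 (by omega)

lemma A_even (m : ℕ) (hm : 1 ≤ m) : A6 (2 * m) = (Fib' m : ℚ) - 1 := by
  unfold A6
  rw [B_even m hm, Nat.cast_mul, Nat.cast_sub (Fib'_pos m)]
  have : ((2 * m : ℕ) : ℚ) ≠ 0 := by exact_mod_cast (by omega : 2 * m ≠ 0)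
  rw [mul_div_cancel_left₀ _ this]; simp

lemma A_odd (m : ℕ) (hm : 1 ≤ m) : A6 (2 * m + 1) = 2 * (Fib' m : ℚ) - 1 := by
  unfold A6
  have h := Fib'_pos m
  rw [B_odd m hm, Nat.cast_mul, Nat.cast_sub (by omega)]
  have : ((2 * m + 1 : ℕ) : ℚ) ≠ 0 := by exact_mod_cast (by omega : 2 * m + 1 ≠ 0)
  rw [mul_div_cancel_left₀ _ this]; simp

lemma Fib'_rec (m : ℕ) : (Fib' (m + 2) : ℚ) = Fib' (m + 1) + Fib' m := by
  unfold Fib'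
  rw [show m + 2 + 1 = (m + 1) + 2 from rfl, Nat.fib_add_two]; push_cast; ring

end Six

/-- `B 6 (2m) = 2m(F_m - 1)` and `B 6 (2m+1) = (2m+1)(2F_m - 1)`; equivalently,
`A6` has the stated initial values and satisfies `A6 d = A6 (d-2) + A6 (d-4) + 1`
for `d ≥ 6`. -/
theorem stmt_7 :
    (∀ m : ℕ, 1 ≤ m →
      B 6 (2 * m) = 2 * m * (Fib' m - 1) ∧
      B 6 (2 * m + 1) = (2 * m + 1) * (2 * Fib' m - 1)) ∧
    (A6 2 = 0 ∧ A6 3 = 1 ∧ A6 4 = 1 ∧ A6 5 = 3 ∧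
      ∀ d : ℕ, 6 ≤ d → A6 d = A6 (d - 2) + A6 (d - 4) + 1) := by
  refine ⟨fun m hm => ⟨Six.B_even m hm, Six.B_odd m hm⟩, ?_, ?_, ?_, ?_, ?_⟩
  · have := Six.A_even 1 le_rfl
    simpa [Fib'] using this
  · have := Six.A_odd 1 le_rfl
    rw [show 2 * 1 + 1 = 3 from rfl] at this
    rw [this]; norm_num [Fib']
  · have := Six.A_even 2 (by norm_num)
    rw [show 2 * 2 = 4 from rfl] at this
    rw [this]; norm_num [Fib', Nat.fib_add_two]
  · have := Six.A_odd 2 (by norm_num)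
    rw [show 2 * 2 + 1 = 5 from rfl] at this
    rw [this]; norm_num [Fib', Nat.fib_add_two]
  · intro d hd
    rcases Nat.even_or_odd' d with ⟨k, rfl | rfl⟩
    · obtain ⟨j, rfl⟩ : ∃ j, k = j + 2 := ⟨k - 2, by omega⟩
      rw [show 2 * (j + 2) - 2 = 2 * (j + 1) by omega, show 2 * (j + 2) - 4 = 2 * j by omega,
        Six.A_even _ (by omega), Six.A_even _ (by omega), Six.A_even _ (by omega), Six.Fib'_rec]
      ring
    · obtain ⟨j, rfl⟩ : ∃ j, k = j + 2 := ⟨k - 2, by omega⟩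
      rw [show 2 * (j + 2) + 1 - 2 = 2 * (j + 1) + 1 by omega,
        show 2 * (j + 2) + 1 - 4 = 2 * j + 1 by omega,
        Six.A_odd _ (by omega), Six.A_odd _ (by omega), Six.A_odd _ (by omega), Six.Fib'_rec]
      ring
end

section
/- Let d be an odd integer with d ≥ 5, and suppose the map τ : F_{2^d} → F_{2^d}, τ(x) = x + x^6, is two-to-one (every element of τ(F_{2^d}) has exactly two preimages; this holds because D(x^6) is the Segre hyperoval). Then the 2-rank of the complement F_{2^d}^* \ D_{6,d} is equal to d·(2F_{(d−1)/2} − 1), where F_n is the n-th Fibonacci number with F₀ = F₁ = 1. -/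
namespace Segre

lemma rank_map_field {K L m : Type*} [Field K] [Field L] [Fintype m] [DecidableEq m]
    (f : K →+* L) (M : Matrix m m K) : (M.map f).rank = M.rank := by
  classical
  obtain ⟨L1, L2, D, h⟩ :=
    Matrix.Pivot.exists_list_transvec_mul_mul_list_transvec_eq_diagonal M
  set V := (L1.map Matrix.TransvectionStruct.toMatrix).prod with hV
  set U := (L2.map Matrix.TransvectionStruct.toMatrix).prod with hU
  have hVd : V.det = 1 := Matrix.TransvectionStruct.det_toMatrix_prod _
  have hUd : U.det = 1 := Matrix.TransvectionStruct.det_toMatrix_prod _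
  have h1 : M.rank = (Matrix.diagonal D).rank := by
    rw [← h, Matrix.rank_mul_eq_left_of_isUnit_det _ _ (by rw [hUd]; exact isUnit_one),
      Matrix.rank_mul_eq_right_of_isUnit_det _ _ (by rw [hVd]; exact isUnit_one)]
  have h' : V.map f * M.map f * U.map f = Matrix.diagonal (fun i => f (D i)) := by
    rw [← Matrix.map_mul, ← Matrix.map_mul, h, Matrix.diagonal_map (map_zero f)]
  have hVd' : (V.map f).det = 1 := by
    have := RingHom.map_det f V
    rw [hVd, map_one] at this
    exact this.symm
  have hUd' : (U.map f).det = 1 := by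
    have := RingHom.map_det f U
    rw [hUd, map_one] at this
    exact this.symm
  have h2 : (M.map f).rank = (Matrix.diagonal (fun i => f (D i))).rank := by
    rw [← h', Matrix.rank_mul_eq_left_of_isUnit_det _ _ (by rw [hUd']; exact isUnit_one),
      Matrix.rank_mul_eq_right_of_isUnit_det _ _ (by rw [hVd']; exact isUnit_one)]
  rw [h1, h2, Matrix.rank_diagonal, Matrix.rank_diagonal]
  simp

lemma rank_circ {F : Type*} [Field F] [Fintype F] [DecidableEq F] [DecidableEq Fˣ] (g : Fˣ → F)
    (hinj : Function.Injective (fun u : Fˣ => u ^ 5)) :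
    (Matrix.of fun u v : Fˣ => g (v * u⁻¹)).rank =
      ((Finset.range (Fintype.card Fˣ)).filter
        (fun a => ∑ y : Fˣ, g y * (((y⁻¹) ^ 5 : Fˣ) : F) ^ a ≠ 0)).card := by
  classical
  set n := Fintype.card Fˣ with hn
  let e : Fˣ ≃ Fin n := Fintype.equivFin Fˣ
  let φ : Fˣ → F := fun y => (((y⁻¹) ^ 5 : Fˣ) : F)
  have hφmul : ∀ x y, φ (x * y) = φ x * φ y := by
    intro x y
    simp only [φ, mul_inv, mul_pow, Units.val_mul]
  let P : Matrix (Fin n) (Fin n) F := Matrix.vandermonde (fun i => φ (e.symm i))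
  have hP : IsUnit P.det := by
    apply IsUnit.mk0
    apply Matrix.det_vandermonde_ne_zero_iff.2
    intro i j hij
    have h1 := Units.val_injective hij
    have h2 := hinj h1
    exact e.symm.injective (inv_injective h2)
  let S : Fin n → F := fun a => ∑ y : Fˣ, g y * φ y ^ (a : ℕ)
  let M := (Matrix.of fun u v : Fˣ => g (v * u⁻¹))
  have key : (M.submatrix e.symm e.symm) * P = P * Matrix.diagonal S := by
    ext i a
    rw [Matrix.mul_diagonal, Matrix.mul_apply]
    simp only [Matrix.submatrix_apply, M, Matrix.of_apply, P, Matrix.vandermonde_apply, S]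
    rw [Equiv.sum_comp e.symm (fun v => g (v * (e.symm i)⁻¹) * φ v ^ (a : ℕ)),
      ← Equiv.sum_comp (Equiv.mulRight (e.symm i)), Finset.mul_sum]
    apply Finset.sum_congr rfl
    intro y _
    simp only [Equiv.coe_mulRight, mul_inv_cancel_right, hφmul, mul_pow]
    ring
  have h1 : M.rank = (Matrix.diagonal S).rank := by
    rw [← Matrix.rank_submatrix M e.symm e.symm,
      ← Matrix.rank_mul_eq_left_of_isUnit_det P _ hP, key,
      Matrix.rank_mul_eq_right_of_isUnit_det _ _ hP]
  change M.rank = _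
  rw [h1, Matrix.rank_diagonal, Fintype.card_subtype]
  apply Finset.card_bij (fun (i : Fin n) _ => (i : ℕ))
  · intro i hi
    simp only [Finset.mem_filter, Finset.mem_univ, true_and] at hi
    exact Finset.mem_filter.2 ⟨Finset.mem_range.2 i.2, hi⟩
  · intro i _ j _ h
    exact Fin.ext h
  · intro b hb
    obtain ⟨hb1, hb2⟩ := Finset.mem_filter.1 hb
    exact ⟨⟨b, Finset.mem_range.1 hb1⟩, Finset.mem_filter.2 ⟨Finset.mem_univ _, hb2⟩, rfl⟩

lemma binom_aux {W : Type*} [CommRing W] (u : W) (e : ℕ) :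
    (u + u ^ 6) ^ e = ∑ j ∈ Finset.range (e + 1), (e.choose j : W) * u ^ (e + 5 * j) := by
  rw [add_comm, add_pow]
  apply Finset.sum_congr rfl
  intro j hj
  have : j ≤ e := by simpa [Nat.lt_succ_iff] using hj
  obtain ⟨k, rfl⟩ := Nat.exists_eq_add_of_le this
  rw [← pow_mul, ← pow_add, mul_comm]
  congr 2
  omega

/-- The key 2-adic computation: power sums over the image of `x + x^6`. -/
lemma image_sum_aux {F : Type*} [Field F] [Fintype F] [DecidableEq F] [CharP F 2]
    {W : Type*} [CommRing W] [IsDomain W] (T : F →* W) (π : W →+* F) (hT0 : T 0 = 0)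
    (hπT : ∀ x, π (T x) = x) (hker : ∀ w : W, π w = 0 → ∃ z, w = 2 * z) (h20 : (2 : W) ≠ 0)
    (h2 : ∀ y : F, (∃ x, x + x ^ 6 = y) →
      ((Finset.univ : Finset F).filter (fun x => x + x ^ 6 = y)).card = 2)
    (n : ℕ) (hn : Fintype.card Fˣ = n) (hnodd : n % 2 = 1)
    (e A : ℕ) (he : 0 < e) (hen : e < n) (heven : e % 2 = 0)
    (hA : ∀ j, j ≤ e → (n ∣ e + 5 * j ↔ j = A)) :
    (∑ y ∈ (Finset.univ : Finset F).image (fun x => x + x ^ 6), y ^ e) ≠ 0 ↔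
      e.choose A % 4 = 2 := by
  classical
  have hTinj : Function.Injective T := fun x y h => by rw [← hπT x, h, hπT]
  -- power sums
  have hps : ∀ m : ℕ, 0 < m → ∑ x : F, T x ^ m = if n ∣ m then (n : W) else 0 := by
    intro m hm
    have h1 : ∑ x : F, T x ^ m = ∑ u : Fˣ, T (u : F) ^ m := by
      rw [← Finset.sum_subset (Finset.subset_univ (Finset.univ.filter (fun x : F => x ≠ 0)))]
      · symm
        apply Finset.sum_bij (fun (u : Fˣ) _ => (u : F))
        · intro u _; simp
        · intro u _ v _ h; exact Units.val_injective h
        · intro b hb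
          simp only [Finset.mem_filter, Finset.mem_univ, true_and] at hb
          exact ⟨Units.mk0 b hb, Finset.mem_univ _, rfl⟩
        · intro u _; rfl
      · intro x _ hx
        simp only [Finset.mem_filter, Finset.mem_univ, true_and, not_not] at hx
        rw [hx, hT0, zero_pow hm.ne']
    let χ : Fˣ →* W := (powMonoidHom m).comp (T.comp (Units.coeHom F))
    have h3 : ∑ u : Fˣ, T (u : F) ^ m = ∑ u : Fˣ, χ u := rfl
    have h4 : χ = 1 ↔ n ∣ m := by
      have hexp : Monoid.exponent Fˣ = n := by
        rw [IsCyclic.exponent_eq_card, Nat.card_eq_fintype_card, hn]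
      rw [← hexp, Monoid.exponent_dvd_iff_forall_pow_eq_one]
      constructor
      · intro h u
        have := DFunLike.congr_fun h u
        have h5 : T ((u : F) ^ m) = T 1 := by
          rw [map_pow, map_one]; exact this
        have h6 := hTinj h5
        apply Units.val_injective
        simpa using h6
      · intro h
        ext1 u
        change T (u : F) ^ m = 1
        rw [← map_pow, ← Units.val_pow_eq_pow_val, h u]
        simp
    rw [h1, h3, sum_hom_units, hn]
    simp only [h4]
    split_ifs <;> simp
  -- congruence mod 4
  obtain ⟨t, ht⟩ : ∃ t, e = 2 * t := ⟨e / 2, by omega⟩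
  have hcong : ∀ x : F, ∃ z : W, T (x + x ^ 6) ^ e = (T x + T x ^ 6) ^ e + 4 * z := by
    intro x
    obtain ⟨z, hz⟩ := hker (T (x + x ^ 6) - (T x + T x ^ 6)) (by
      simp only [map_sub, map_add, map_pow, hπT, sub_self])
    have h1 : T (x + x ^ 6) = (T x + T x ^ 6) + 2 * z := by rw [← hz]; ring
    have h2 : T (x + x ^ 6) ^ 2 - (T x + T x ^ 6) ^ 2 = 4 * ((T x + T x ^ 6) * z + z ^ 2) := by
      rw [h1]; ring
    have h3 := sub_dvd_pow_sub_pow (T (x + x ^ 6) ^ 2) ((T x + T x ^ 6) ^ 2) t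
    rw [h2] at h3
    obtain ⟨w, hw⟩ := h3
    refine ⟨((T x + T x ^ 6) * z + z ^ 2) * w, ?_⟩
    rw [ht, pow_mul, pow_mul, ← sub_eq_iff_eq_add', hw]
    ring
  choose z hz using hcong
  set I := (Finset.univ : Finset F).image (fun x => x + x ^ 6) with hI
  have hsum1 : ∑ x : F, T (x + x ^ 6) ^ e = 2 * ∑ y ∈ I, T y ^ e := by
    rw [Finset.sum_comp (fun y => T y ^ e) (fun x : F => x + x ^ 6), Finset.mul_sum]
    apply Finset.sum_congr rfl
    intro y hy
    rw [h2 y (by simpa [hI] using hy)]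
    simp
  have hsum2 : ∑ x : F, T (x + x ^ 6) ^ e = (e.choose A : W) * n + 4 * ∑ x : F, z x := by
    simp only [hz, Finset.sum_add_distrib, ← Finset.mul_sum, binom_aux]
    congr 1
    rw [Finset.sum_comm]
    have : ∀ j ∈ Finset.range (e + 1), ∑ x : F, (e.choose j : W) * T x ^ (e + 5 * j) =
        if j = A then (e.choose A : W) * n else 0 := by
      intro j hj
      have hje : j ≤ e := by simpa [Nat.lt_succ_iff] using hj
      rw [← Finset.mul_sum, hps _ (by omega)]
      simp only [hA j hje]
      split_ifs with h
      · rw [h]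
      · simp
    rw [Finset.sum_congr rfl this, Finset.sum_ite_eq']
    split_ifs with h
    · rfl
    · rw [Nat.choose_eq_zero_of_lt (by simpa using h)]
      simp
  have hmain : 2 * ∑ y ∈ I, T y ^ e = (e.choose A : W) * n + 4 * ∑ x : F, z x := by
    rw [← hsum1, hsum2]
  have hF2 : (2 : F) = 0 := by exact_mod_cast CharP.cast_eq_zero F 2
  have hev : 2 ∣ e.choose A := by
    have h := congrArg π hmain
    have h4 : (4 : F) = 0 := by
      have : (4 : F) = 2 * 2 := by norm_num
      rw [this, hF2, zero_mul]
    simp only [map_mul, map_add, map_natCast, map_ofNat, hF2, h4, zero_mul, add_zero] at h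
    have h5 : ((e.choose A * n : ℕ) : F) = 0 := by push_cast; exact h.symm
    rw [CharP.cast_eq_zero_iff F 2] at h5
    rcases (Nat.prime_two.dvd_mul).1 h5 with h6 | h6
    · exact h6
    · omega
  obtain ⟨c, hc⟩ := hev
  have h7 : ∑ y ∈ I, T y ^ e = (c : W) * n + 2 * ∑ x : F, z x := by
    apply mul_left_cancel₀ h20
    rw [hmain, hc]
    push_cast
    ring
  have h8 : ∑ y ∈ I, y ^ e = ((c * n : ℕ) : F) := by
    have h := congrArg π h7
    simp only [map_sum, map_pow, hπT, map_mul, map_add, map_natCast, map_ofNat, hF2, zero_mul,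
      add_zero] at h
    rw [h]; push_cast; rfl
  rw [h8, Ne, CharP.cast_eq_zero_iff F 2, Nat.prime_two.dvd_mul, hc]
  omega

/-- The key 2-adic computation: power sums over the image of `x + x^6`. -/
lemma image_sum {F : Type*} [Field F] [Fintype F] [DecidableEq F] [CharP F 2]
    (h2 : ∀ y : F, (∃ x, x + x ^ 6 = y) →
      ((Finset.univ : Finset F).filter (fun x => x + x ^ 6 = y)).card = 2)
    (n : ℕ) (hn : Fintype.card Fˣ = n) (hnodd : n % 2 = 1)
    (e A : ℕ) (he : 0 < e) (hen : e < n) (heven : e % 2 = 0)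
    (hA : ∀ j, j ≤ e → (n ∣ e + 5 * j ↔ j = A)) :
    (∑ y ∈ (Finset.univ : Finset F).image (fun x => x + x ^ 6), y ^ e) ≠ 0 ↔
      e.choose A % 4 = 2 := by
  have : Fact (Nat.Prime 2) := ⟨Nat.prime_two⟩
  refine image_sum_aux (W := WittVector 2 F) (WittVector.teichmuller 2) WittVector.constantCoeff
    (WittVector.teichmuller_zero 2) (fun x => WittVector.teichmuller_coeff_zero 2 x) ?_ ?_
    h2 n hn hnodd e A he hen heven hA
  · intro w hw
    have : w ∈ RingHom.ker (WittVector.constantCoeff : WittVector 2 F →+* F) := hw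
    rw [WittVector.ker_constantCoeff, Ideal.mem_span_singleton] at this
    obtain ⟨z, hz⟩ := this
    exact ⟨z, by simpa using hz⟩
  · have := WittVector.p_nonzero 2 F
    simpa using this

/-- cyclic carry out of the top position in the addition `x + 5 x` modulo `n` -/
def car (n x : ℕ) : Prop := n < x % n + (5 * x) % n

instance (n x : ℕ) : Decidable (car n x) := by unfold car; infer_instance

/-- number of cyclic carries in the addition `a + 5 a` modulo `2 ^ d - 1` -/
def numCar (d a : ℕ) : ℕ := ((Finset.range d).filter (fun i => car (2 ^ d - 1) (2 ^ i * a))).card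

lemma car_congr {n x y : ℕ} (h : x ≡ y [MOD n]) : car n x ↔ car n y := by
  have h5 : 5 * x ≡ 5 * y [MOD n] := h.mul_left 5
  unfold Nat.ModEq at h h5
  unfold car
  rw [h, h5]

lemma pow_d_mod (d x : ℕ) : 2 ^ d * x ≡ x [MOD (2 ^ d - 1)] := by
  have h1 : 1 ≤ 2 ^ d := Nat.one_le_two_pow
  have h : 2 ^ d ≡ 1 [MOD (2 ^ d - 1)] :=
    ((Nat.modEq_iff_dvd' h1).2 dvd_rfl).symm
  simpa using h.mul_right x

lemma numCar_congr {d a b : ℕ} (h : a ≡ b [MOD (2 ^ d - 1)]) : numCar d a = numCar d b := by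
  unfold numCar
  congr 1
  apply Finset.filter_congr
  intro i _
  exact car_congr (h.mul_left _)

lemma numCar_two_mul (d a : ℕ) : numCar d (2 * a) = numCar d a := by
  unfold numCar
  simp only [Finset.card_filter]
  have h1 : ∀ i, (if car (2 ^ d - 1) (2 ^ i * (2 * a)) then 1 else 0) =
      (fun i => if car (2 ^ d - 1) (2 ^ i * a) then 1 else 0) (i + 1) := by
    intro i
    have : 2 ^ i * (2 * a) = 2 ^ (i + 1) * a := by ring
    simp only [this]
  simp only [h1]
  have h2 := Finset.sum_range_succ (fun i => if car (2 ^ d - 1) (2 ^ i * a) then 1 else 0) d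
  have h3 := Finset.sum_range_succ' (fun i => if car (2 ^ d - 1) (2 ^ i * a) then 1 else 0) d
  have h4 : car (2 ^ d - 1) (2 ^ d * a) ↔ car (2 ^ d - 1) (2 ^ 0 * a) := by
    apply car_congr
    simpa using pow_d_mod d a
  simp only [h4] at h2
  omega

lemma rot_val {d i A : ℕ} (hi : i ≤ d) (hA : A < 2 ^ d - 1) :
    (2 ^ (d - i) * A) % (2 ^ d - 1) = (A % 2 ^ i) * 2 ^ (d - i) + A / 2 ^ i := by
  have hp : 0 < 2 ^ i := by positivity
  have hr : 0 < 2 ^ (d - i) := by positivity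
  have hpr : 2 ^ i * 2 ^ (d - i) = 2 ^ d := by rw [← pow_add]; congr 1; omega
  have hdm := Nat.div_add_mod A (2 ^ i)
  have hlt := Nat.mod_lt A hp
  have hmod : 2 ^ (d - i) * A ≡ (A % 2 ^ i) * 2 ^ (d - i) + A / 2 ^ i [MOD (2 ^ d - 1)] := by
    have h1 : 2 ^ (d - i) * A = (A % 2 ^ i) * 2 ^ (d - i) + 2 ^ d * (A / 2 ^ i) := by
      conv_lhs => rw [← hdm]
      rw [← hpr]; ring
    rw [h1]
    exact (pow_d_mod d _).add_left _
  rw [hmod, Nat.mod_eq_of_lt]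
  have hq : A / 2 ^ i < 2 ^ (d - i) := by
    rw [Nat.div_lt_iff_lt_mul hp, mul_comm, hpr]; omega
  generalize A / 2 ^ i = q at *
  generalize A % 2 ^ i = r at *
  generalize 2 ^ i = p at *
  generalize 2 ^ (d - i) = s at *
  generalize 2 ^ d = N at *
  subst hpr
  by_cases h : r + 1 < p
  · have : (r + 2) * s ≤ p * s := Nat.mul_le_mul_right _ h
    have e : (r + 2) * s = r * s + 2 * s := by ring
    omega
  · have hr' : p = r + 1 := by omega
    subst hr'
    have e : (r + 1) * s = r * s + s := by ring
    by_contra hcon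
    have hq' : q + 1 = s := by omega
    subst hq'
    have e2 : (r + 1) * (q + 1) = (r + 1) * q + r + 1 := by ring
    omega

lemma kummer_aux {A e p : ℕ} (hp : 0 < p) (h : A ≤ e) :
    p ≤ A % p + (e - A) % p ↔ e % p < A % p := by
  obtain ⟨k, rfl⟩ := Nat.exists_eq_add_of_le h
  rw [Nat.add_sub_cancel_left, Nat.add_mod]
  have h1 := Nat.mod_lt A hp
  have h2 := Nat.mod_lt k hp
  by_cases h3 : A % p + k % p < p
  · rw [Nat.mod_eq_of_lt h3]; omega
  · have h4 : (A % p + k % p) % p = A % p + k % p - p := by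
      rw [Nat.mod_eq_sub_mod (not_lt.1 h3), Nat.mod_eq_of_lt (by omega)]
    omega

lemma mul_neg_mod {n e B r : ℕ} (hn : 0 < n) (h : B + e = n) (hr : (r * e) % n ≠ 0) :
    (r * B) % n + (r * e) % n = n := by
  have h1 : (r * B + r * e) % n = 0 := by rw [← mul_add, h]; exact Nat.mul_mod_left _ _
  rw [Nat.add_mod] at h1
  have h2 := Nat.mod_lt (r * B) hn
  have h3 := Nat.mod_lt (r * e) hn
  by_cases h4 : (r * B) % n + (r * e) % n < n
  · rw [Nat.mod_eq_of_lt h4] at h1; omega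
  · rw [Nat.mod_eq_sub_mod (by omega), Nat.mod_eq_of_lt (by omega)] at h1; omega

lemma pow_coprime {d : ℕ} (hd : 0 < d) (i : ℕ) : Nat.Coprime (2 ^ d - 1) (2 ^ i) := by
  apply Nat.Coprime.pow_right
  rw [Nat.coprime_two_right]
  have : 2 ∣ 2 ^ d := dvd_pow_self 2 hd.ne'
  have : 1 ≤ 2 ^ d := Nat.one_le_two_pow
  rw [Nat.odd_iff]
  omega

/-- carries of rotations in terms of borrows -/
lemma car_iff {d a e i : ℕ} (hd : 0 < d) (he0 : 0 < e) (he : (5 * a) % (2 ^ d - 1) + e = 2 ^ d - 1)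
    (hen : e < 2 ^ d - 1) :
    car (2 ^ d - 1) (2 ^ i * a) ↔
      (2 ^ i * e) % (2 ^ d - 1) < (2 ^ i * a) % (2 ^ d - 1) := by
  have hn : 0 < 2 ^ d - 1 := by omega
  have hne : (2 ^ i * e) % (2 ^ d - 1) ≠ 0 := by
    intro h
    have h1 := (pow_coprime hd i).dvd_of_dvd_mul_left (Nat.dvd_of_mod_eq_zero h)
    have := Nat.le_of_dvd he0 h1
    omega
  have h := mul_neg_mod hn he hne
  have h2 : (5 * (2 ^ i * a)) % (2 ^ d - 1) = (2 ^ i * ((5 * a) % (2 ^ d - 1))) % (2 ^ d - 1) := by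
    rw [Nat.mul_mod_mod]; congr 1; ring
  unfold car
  rw [h2]
  omega

lemma car_rot {d a e i : ℕ} (hid : i ≤ d) (he0 : 0 < e)
    (hd : 0 < d) (he : (5 * a) % (2 ^ d - 1) + e = 2 ^ d - 1)
    (hen : e < 2 ^ d - 1) (hae : a ≤ e) :
    car (2 ^ d - 1) (2 ^ (d - i) * a) ↔ e % 2 ^ i < a % 2 ^ i := by
  rw [car_iff hd he0 he hen, rot_val hid hen, rot_val hid (by omega)]
  have hp : 0 < 2 ^ i := by positivity
  have hq : e / 2 ^ i < 2 ^ (d - i) := by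
    rw [Nat.div_lt_iff_lt_mul hp, ← pow_add]
    have : d - i + i = d := by omega
    rw [this]; omega
  have hq2 : a / 2 ^ i ≤ e / 2 ^ i := Nat.div_le_div_right hae
  generalize 2 ^ (d - i) = s at *
  generalize e / 2 ^ i = e1 at *
  generalize a / 2 ^ i = a1 at *
  generalize e % 2 ^ i = e0 at *
  generalize a % 2 ^ i = a0 at *
  constructor
  · intro h
    by_contra hc
    have : a0 * s ≤ e0 * s := Nat.mul_le_mul_right _ (by omega)
    omega
  · intro h
    have : (e0 + 1) * s ≤ a0 * s := Nat.mul_le_mul_right _ h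
    have e : (e0 + 1) * s = e0 * s + s := by ring
    omega

lemma mod4_iff {c : ℕ} (hc : c ≠ 0) : c % 4 = 2 ↔ padicValNat 2 c = 1 := by
  have : Fact (Nat.Prime 2) := ⟨Nat.prime_two⟩
  have h1 := @padicValNat_dvd_iff_le 2 _ c 1 hc
  have h2 := @padicValNat_dvd_iff_le 2 _ c 2 hc
  norm_num at h1 h2
  omega

lemma choose_iff {d a e : ℕ} (hd : 2 ≤ d) (ha : a < 2 ^ d - 1) (he0 : 0 < e)
    (he : (5 * a) % (2 ^ d - 1) + e = 2 ^ d - 1) (hen : e < 2 ^ d - 1) (heven : e % 2 = 0) :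
    e.choose a % 4 = 2 ↔ numCar d a = 1 := by
  have hd0 : 0 < d := by omega
  have : Fact (Nat.Prime 2) := ⟨Nat.prime_two⟩
  by_cases hae : a ≤ e
  · rw [mod4_iff (Nat.choose_pos hae).ne', padicValNat_choose (b := d) hae
      (Nat.log_lt_of_lt_pow he0.ne' (by omega))]
    have : (Finset.Ico 1 d |>.filter (fun i => 2 ^ i ≤ a % 2 ^ i + (e - a) % 2 ^ i)).card =
        numCar d a := by
      unfold numCar
      apply Finset.card_bij (fun i _ => d - i)
      · intro i hi
        simp only [Finset.mem_filter, Finset.mem_Ico, Finset.mem_range] at hi ⊢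
        refine ⟨by omega, ?_⟩
        rw [car_rot (by omega) he0 hd0 he hen hae]
        exact (kummer_aux (by positivity) hae).1 hi.2
      · intro i hi j hj h
        simp only [Finset.mem_filter, Finset.mem_Ico] at hi hj
        omega
      · intro b hb
        simp only [Finset.mem_filter, Finset.mem_Ico, Finset.mem_range] at hb ⊢
        have hb0 : b ≠ 0 := by
          rintro rfl
          have h := (car_rot (i := d) le_rfl he0 hd0 he hen hae).1 (by simpa using hb.2)
          rw [Nat.mod_eq_of_lt (by omega), Nat.mod_eq_of_lt (by omega)] at h
          omega
        refine ⟨d - b, ⟨by omega, ?_⟩, by omega⟩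
        rw [kummer_aux (by positivity) hae, ← car_rot (by omega) he0 hd0 he hen hae]
        have : d - (d - b) = b := by omega
        rw [this]; exact hb.2
    rw [this]
  · rw [Nat.choose_eq_zero_of_lt (by omega)]
    simp only [Nat.zero_mod, OfNat.zero_ne_ofNat, false_iff]
    intro h
    unfold numCar at h
    have h0 : car (2 ^ d - 1) (2 ^ 0 * a) := by
      rw [car_iff hd0 he0 he hen]
      simp only [pow_zero, one_mul]
      rw [Nat.mod_eq_of_lt hen, Nat.mod_eq_of_lt ha]
      omega
    have h1 : car (2 ^ d - 1) (2 ^ (d - 1) * a) := by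
      rw [car_iff hd0 he0 he hen, rot_val (by omega) hen, rot_val (by omega) ha]
      simp only [pow_one, heven, zero_mul, zero_add]
      have : e / 2 < 2 ^ (d - 1) := by
        rw [Nat.div_lt_iff_lt_mul two_pos, ← pow_succ]
        have : d - 1 + 1 = d := by omega
        rw [this]; omega
      rcases Nat.mod_two_eq_zero_or_one a with h2 | h2
      · rw [h2]; omega
      · rw [h2]; omega
    rw [Finset.card_eq_one] at h
    obtain ⟨x, hx⟩ := h
    have m0 : 0 ∈ ({x} : Finset ℕ) := by
      rw [← hx]; simp only [Finset.mem_filter, Finset.mem_range]; exact ⟨hd0, h0⟩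
    have m1 : d - 1 ∈ ({x} : Finset ℕ) := by
      rw [← hx]; simp only [Finset.mem_filter, Finset.mem_range]; exact ⟨by omega, h1⟩
    simp only [Finset.mem_singleton] at m0 m1
    omega


/-- no carries in the lowest `m` positions of `A + (5 A + t)` -/
def gd (m t A : ℕ) : Prop := ∀ i, i ≤ m → A % 2 ^ i + (5 * A + t) % 2 ^ i < 2 ^ i

open scoped Classical in
/-- transfer-matrix counts -/
noncomputable def cnt (m t q : ℕ) : ℕ :=
  ((Finset.range (2 ^ m)).filter (fun A => gd m t A ∧ (5 * A + t) / 2 ^ m = q)).card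

lemma two_mod_pow (x k : ℕ) : x % 2 ^ (k + 1) = 2 * ((x / 2) % 2 ^ k) + x % 2 := by
  rw [pow_succ', Nat.mod_mul]
  ring

lemma gd_succ (m t A : ℕ) (α : ℕ) (hα : α < 2) :
    gd (m + 1) t (2 * A + α) ↔ (α = 1 → t % 2 = 1) ∧ gd m ((5 * α + t) / 2) A := by
  have h1 : (2 * A + α) / 2 = A := by omega
  have h2 : (2 * A + α) % 2 = α := by omega
  have h3 : (5 * (2 * A + α) + t) / 2 = 5 * A + (5 * α + t) / 2 := by omega
  have h4 : (5 * (2 * A + α) + t) % 2 = (α + t) % 2 := by omega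
  constructor
  · intro h
    have h0 := h 1 (by omega)
    rw [pow_one, h2, h4] at h0
    refine ⟨fun h => by omega, ?_⟩
    intro i hi
    have h5 := h (i + 1) (by omega)
    rw [two_mod_pow, two_mod_pow (5 * (2 * A + α) + t), h1, h2, h3, h4, pow_succ] at h5
    omega
  · rintro ⟨hb, h⟩ i hi
    rcases i with _ | i
    · simp [Nat.mod_one]
    have h5 := h i (by omega)
    rw [two_mod_pow, two_mod_pow (5 * (2 * A + α) + t), h1, h2, h3, h4, pow_succ]
    omega

lemma card_split (N : ℕ) (P : ℕ → Prop) [DecidablePred P] :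
    ((Finset.range (N * 2)).filter P).card =
      ((Finset.range N).filter (fun A => P (2 * A + 0))).card +
      ((Finset.range N).filter (fun A => P (2 * A + 1))).card := by
  simp only [Finset.card_filter]
  induction N with
  | zero => simp
  | succ N ih =>
    rw [Nat.succ_mul, Finset.sum_range_succ, Finset.sum_range_succ, ih, Finset.sum_range_succ,
      Finset.sum_range_succ]
    have : N * 2 = 2 * N + 0 := by ring
    rw [this]
    ring

lemma cnt_succ (m t q : ℕ) :
    cnt (m + 1) t q = cnt m (t / 2) q + if t % 2 = 1 then cnt m ((5 + t) / 2) q else 0 := by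
  classical
  unfold cnt
  rw [pow_succ, card_split]
  have h3 : ∀ A α, (5 * (2 * A + α) + t) / (2 ^ m * 2) = (5 * A + (5 * α + t) / 2) / 2 ^ m := by
    intro A α
    rw [mul_comm (2 ^ m) 2, ← Nat.div_div_eq_div_mul]
    congr 1
    omega
  simp only [h3, gd_succ m t _ 0 (by norm_num), gd_succ m t _ 1 (by norm_num)]
  by_cases ht : t % 2 = 1 <;> simp [ht]

lemma cnt_zero (t q : ℕ) : cnt 0 t q = if t = q then 1 else 0 := by
  classical
  unfold cnt gd
  by_cases h : t = q <;> simp [h, Nat.mod_one]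

lemma cnt_step (m q : ℕ) : cnt (m + 1) 0 q = cnt m 0 q ∧ cnt (m + 1) 1 q = cnt m 0 q + cnt m 3 q ∧
    cnt (m + 1) 2 q = cnt m 1 q ∧ cnt (m + 1) 3 q = cnt m 1 q + cnt m 4 q ∧
    cnt (m + 1) 4 q = cnt m 2 q := by
  refine ⟨?_, ?_, ?_, ?_, ?_⟩ <;> rw [cnt_succ] <;> norm_num

lemma cnt_a (k : ℕ) : cnt (2 * k + 1) 0 0 = 1 ∧ cnt (2 * k + 1) 1 0 + 1 = Nat.fib (k + 3) ∧
    cnt (2 * k + 1) 4 0 + 1 = Nat.fib (k + 2) := by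
  induction k with
  | zero =>
    obtain ⟨h0, h1, h2, h3, h4⟩ := cnt_step 0 0
    simp only [cnt_zero] at *
    norm_num at *
    simp only [h0, h1, h4]
    decide
  | succ k ih =>
    obtain ⟨h0, h1, h2, h3, h4⟩ := cnt_step (2 * k + 1) 0
    obtain ⟨g0, g1, g2, g3, g4⟩ := cnt_step (2 * k + 1 + 1) 0
    have e : 2 * (k + 1) + 1 = 2 * k + 1 + 1 + 1 := by ring
    have f1 := Nat.fib_add_two (n := k + 2)
    have e1 : k + 1 + 3 = k + 2 + 2 := by ring
    have e2 : k + 1 + 2 = k + 3 := by ring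
    have e3 : k + 2 + 1 = k + 3 := by ring
    rw [e3] at f1
    rw [e, e1, e2]
    omega

lemma cnt_b (k : ℕ) : cnt (2 * k + 1) 0 4 = 0 ∧ cnt (2 * k + 1) 2 4 = Nat.fib k ∧
    cnt (2 * k + 1) 3 4 = Nat.fib (k + 1) := by
  induction k with
  | zero =>
    obtain ⟨h0, h1, h2, h3, h4⟩ := cnt_step 0 4
    simp only [cnt_zero] at *
    norm_num at *
    simp [h0, h2, h3]
  | succ k ih =>
    obtain ⟨h0, h1, h2, h3, h4⟩ := cnt_step (2 * k + 1) 4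
    obtain ⟨g0, g1, g2, g3, g4⟩ := cnt_step (2 * k + 1 + 1) 4
    have e : 2 * (k + 1) + 1 = 2 * k + 1 + 1 + 1 := by ring
    have f1 := Nat.fib_add_two (n := k)
    have e1 : k + 1 + 1 = k + 2 := by ring
    rw [e, e1]
    omega

lemma cnt_total (k : ℕ) : cnt (2 * k + 1) 1 0 + cnt (2 * k + 1) 2 4 = 2 * Nat.fib (k + 2) - 1 := by
  have h1 := cnt_a k
  have h2 := cnt_b k
  have f1 := Nat.fib_add_two (n := k)
  have f2 := Nat.fib_add_two (n := k + 1)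
  have e1 : k + 1 + 2 = k + 3 := by ring
  have e2 : k + 1 + 1 = k + 2 := by ring
  rw [e1, e2] at f2
  omega

lemma low_aux {d i A B : ℕ} (hi : i ≤ d) (hA : A < 2 ^ d - 1) (hB : B < 2 ^ d - 1)
    (hAB : 2 ^ d - 1 < A + B) :
    (2 ^ d - 1 < (2 ^ (d - i) * A) % (2 ^ d - 1) + (2 ^ (d - i) * B) % (2 ^ d - 1)) ↔
      ¬ (A % 2 ^ i + B % 2 ^ i + 1 < 2 ^ i) := by
  rw [rot_val hi hA, rot_val hi hB]
  have hp : 0 < 2 ^ i := by positivity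
  have hpr : 2 ^ i * 2 ^ (d - i) = 2 ^ d := by rw [← pow_add]; congr 1; omega
  have hqA : A / 2 ^ i < 2 ^ (d - i) := by
    rw [Nat.div_lt_iff_lt_mul hp, mul_comm, hpr]; omega
  have hqB : B / 2 ^ i < 2 ^ (d - i) := by
    rw [Nat.div_lt_iff_lt_mul hp, mul_comm, hpr]; omega
  have dA := Nat.div_add_mod A (2 ^ i)
  have dB := Nat.div_add_mod B (2 ^ i)
  have hA0 := Nat.mod_lt A hp
  have hB0 := Nat.mod_lt B hp
  generalize A / 2 ^ i = A1 at *
  generalize A % 2 ^ i = A0 at *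
  generalize B / 2 ^ i = B1 at *
  generalize B % 2 ^ i = B0 at *
  generalize 2 ^ i = p at *
  generalize 2 ^ (d - i) = s at *
  generalize 2 ^ d = N at *
  subst hpr
  have hs : A0 * s + B0 * s = (A0 + B0) * s := by ring
  constructor
  · intro h hc
    have h1 : (A0 + B0 + 2) * s ≤ p * s := Nat.mul_le_mul_right _ (by omega)
    have h2 : (A0 + B0 + 2) * s = (A0 + B0) * s + 2 * s := by ring
    omega
  · intro h
    by_cases h1 : p ≤ A0 + B0
    · have h2 : p * s ≤ (A0 + B0) * s := Nat.mul_le_mul_right _ h1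
      have h3 : 0 < p * s := by omega
      omega
    · have h2 : p = A0 + B0 + 1 := by omega
      have h3 : s ≤ A1 + B1 := by
        by_contra hc
        have h4 : p * (A1 + B1 + 1) ≤ p * s := Nat.mul_le_mul_left _ (by omega)
        have h5 : p * (A1 + B1 + 1) = p * A1 + p * B1 + p := by ring
        omega
      have h6 : p * s = (A0 + B0) * s + s := by rw [h2]; ring
      have h3 : 0 < p * s := by omega
      omega

lemma pat_iff {d a : ℕ} (hd : 2 ≤ d) (ha : a < 2 ^ d - 1) :
    (numCar d a = 1 ∧ car (2 ^ d - 1) a) ↔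
      (2 ^ d - 1 < a + (5 * a) % (2 ^ d - 1) ∧
        ∀ i, 0 < i → i < d → a % 2 ^ i + ((5 * a) % (2 ^ d - 1)) % 2 ^ i + 1 < 2 ^ i) := by
  have hn : 0 < 2 ^ d - 1 := by omega
  have hB := Nat.mod_lt (5 * a) hn
  have hc0 : car (2 ^ d - 1) a ↔ 2 ^ d - 1 < a + (5 * a) % (2 ^ d - 1) := by
    unfold car; rw [Nat.mod_eq_of_lt ha]
  rw [and_comm, hc0]
  apply and_congr_right
  intro hAB
  have hcar : ∀ i, i ≤ d → (car (2 ^ d - 1) (2 ^ (d - i) * a) ↔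
      ¬ (a % 2 ^ i + ((5 * a) % (2 ^ d - 1)) % 2 ^ i + 1 < 2 ^ i)) := by
    intro i hi
    rw [← low_aux hi ha hB hAB]
    unfold car
    rw [Nat.mul_mod_mod]
    have : 5 * (2 ^ (d - i) * a) = 2 ^ (d - i) * (5 * a) := by ring
    rw [this]
  constructor
  · intro h i hi0 hid
    by_contra hcon
    have h1 := (hcar i hid.le).2 hcon
    unfold numCar at h
    rw [Finset.card_eq_one] at h
    obtain ⟨x, hx⟩ := h
    have m0 : 0 ∈ ({x} : Finset ℕ) := by
      rw [← hx]
      simp only [Finset.mem_filter, Finset.mem_range]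
      exact ⟨by omega, by rw [pow_zero, one_mul]; exact hc0.2 hAB⟩
    have m1 : d - i ∈ ({x} : Finset ℕ) := by
      rw [← hx]; simp only [Finset.mem_filter, Finset.mem_range]; exact ⟨by omega, h1⟩
    simp only [Finset.mem_singleton] at m0 m1
    omega
  · intro h
    unfold numCar
    rw [Finset.card_eq_one]
    refine ⟨0, ?_⟩
    ext j
    simp only [Finset.mem_filter, Finset.mem_range, Finset.mem_singleton]
    constructor
    · rintro ⟨hj, hc⟩
      by_contra hj0
      have := (hcar (d - j) (by omega)).1 (by
        have : d - (d - j) = j := by omega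
        rw [this]; exact hc)
      exact this (h (d - j) (by omega) (by omega))
    · rintro rfl
      exact ⟨by omega, by rw [pow_zero, one_mul]; exact hc0.2 hAB⟩

lemma shift_mod {m k x : ℕ} (hk : k ≤ m) (r : ℕ) : (x + r * 2 ^ m) % 2 ^ k = x % 2 ^ k := by
  obtain ⟨l, rfl⟩ := Nat.exists_eq_add_of_le hk
  rw [pow_add]
  have : x + r * (2 ^ k * 2 ^ l) = x + 2 ^ k * (r * 2 ^ l) := by ring
  rw [this, Nat.add_mul_mod_self_left]

lemma low_pat {m k x y : ℕ} (hk : k ≤ m) :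
    ((2 * x + 2 * 2 ^ m) % 2 ^ (k + 1) + (2 * y + 2 * 2 ^ m) % 2 ^ (k + 1) + 1 < 2 ^ (k + 1)) ↔
      x % 2 ^ k + y % 2 ^ k < 2 ^ k := by
  rw [two_mod_pow, two_mod_pow (2 * y + 2 * 2 ^ m)]
  have h1 : (2 * x + 2 * 2 ^ m) / 2 = x + 1 * 2 ^ m := by omega
  have h2 : (2 * y + 2 * 2 ^ m) / 2 = y + 1 * 2 ^ m := by omega
  rw [h1, h2, shift_mod hk, shift_mod hk, pow_succ]
  omega

lemma count_norm {d m : ℕ} (hd : d = m + 2) :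
    ((Finset.range (2 ^ d - 1)).filter (fun a => numCar d a = 1 ∧ car (2 ^ d - 1) a)).card =
      cnt m 1 0 + cnt m 2 4 := by
  classical
  have hM : 0 < 2 ^ m := by positivity
  have hN : 2 ^ d = 4 * 2 ^ m := by rw [hd, pow_add]; ring
  unfold cnt
  rw [← Finset.card_union_of_disjoint]
  · symm
    apply Finset.card_bij (fun x _ => 2 * x + 2 * 2 ^ m)
    · intro x hx
      have main : ∀ t q r, t = 1 ∧ q = 2 ∧ r = 0 ∨ t = 2 ∧ q = 4 ∧ r = 4 → x < 2 ^ m → gd m t x →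
          (5 * x + t) / 2 ^ m = r → 2 * x + 2 * 2 ^ m < 2 ^ d - 1 ∧
          numCar d (2 * x + 2 * 2 ^ m) = 1 ∧ car (2 ^ d - 1) (2 * x + 2 * 2 ^ m) := by
        intro t q r htq hx hg hr
        have ha : 2 * x + 2 * 2 ^ m < 2 ^ d - 1 := by omega
        refine ⟨ha, ?_⟩
        rw [pat_iff (by omega) ha]
        have hdm := Nat.div_add_mod (5 * x + t) (2 ^ m)
        have hc := Nat.mod_lt (5 * x + t) hM
        rw [hr] at hdm
        set c := (5 * x + t) % 2 ^ m with hcdef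
        have hB : (5 * (2 * x + 2 * 2 ^ m)) % (2 ^ d - 1) = 2 * c + 2 * 2 ^ m := by
          have e1 : 5 * (2 * x + 2 * 2 ^ m) = (2 * c + 2 * 2 ^ m) + (2 ^ d - 1) * q := by
            rcases htq with ⟨rfl, rfl, rfl⟩ | ⟨rfl, rfl, rfl⟩ <;> omega
          rw [e1, Nat.add_mul_mod_self_left, Nat.mod_eq_of_lt (by omega)]
        rw [hB]
        refine ⟨by omega, ?_⟩
        intro i hi0 hid
        obtain ⟨k, rfl⟩ : ∃ k, i = k + 1 := ⟨i - 1, by omega⟩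
        have hk : k ≤ m := by omega
        rw [low_pat hk]
        have := hg k hk
        have e2 : 5 * x + t = c + r * 2 ^ m := by rw [← hdm]; ring
        rw [e2, shift_mod hk] at this
        exact this
      simp only [Finset.mem_union, Finset.mem_filter, Finset.mem_range] at hx ⊢
      rcases hx with ⟨h1, h2, h3⟩ | ⟨h1, h2, h3⟩
      · exact main 1 2 0 (by simp) h1 h2 h3
      · exact main 2 4 4 (by simp) h1 h2 h3
    · intro x _ y _ h
      have h' : 2 * x + 2 * 2 ^ m = 2 * y + 2 * 2 ^ m := h
      omega
    · intro a ha
      simp only [Finset.mem_filter, Finset.mem_range] at ha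
      obtain ⟨ha, hpat⟩ := ha
      rw [pat_iff (by omega) ha] at hpat
      obtain ⟨hAB, hlow⟩ := hpat
      have hn : 0 < 2 ^ d - 1 := by omega
      have hB := Nat.mod_lt (5 * a) hn
      have hdm := Nat.div_add_mod (5 * a) (2 ^ d - 1)
      have hQ : 5 * a / (2 ^ d - 1) < 5 := by
        rw [Nat.div_lt_iff_lt_mul hn]; omega
      generalize hBd : 5 * a % (2 ^ d - 1) = B at *
      generalize 5 * a / (2 ^ d - 1) = Q at *
      have l1 := hlow 1 (by omega) (by omega)
      rw [pow_one] at l1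
      have hform : ∃ x y, x < 2 ^ m ∧ y < 2 ^ m ∧ a = 2 * x + 2 * 2 ^ m ∧
          B = 2 * y + 2 * 2 ^ m := by
        have l2 : a % (2 * 2 ^ m) + B % (2 * 2 ^ m) + 1 < 2 * 2 ^ m := by
          rcases Nat.eq_zero_or_pos m with h0 | h0
          · subst h0
            simp only [pow_zero, mul_one]
            omega
          · have := hlow (m + 1) (by omega) (by omega)
            rwa [pow_succ'] at this
        have hM2 : 0 < 2 * 2 ^ m := by omega
        have d1 := Nat.div_add_mod a (2 * 2 ^ m)
        have d2 := Nat.div_add_mod B (2 * 2 ^ m)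
        have q1 : a / (2 * 2 ^ m) < 2 := by rw [Nat.div_lt_iff_lt_mul hM2]; omega
        have q2 : B / (2 * 2 ^ m) < 2 := by rw [Nat.div_lt_iff_lt_mul hM2]; omega
        have q3 : 2 * 2 ^ m ≤ a ∧ 2 * 2 ^ m ≤ B := by
          generalize a / (2 * 2 ^ m) = u at *
          generalize B / (2 * 2 ^ m) = v at *
          interval_cases u <;> interval_cases v <;> omega
        exact ⟨(a - 2 * 2 ^ m) / 2, (B - 2 * 2 ^ m) / 2, by omega, by omega, by omega, by omega⟩
      obtain ⟨x, y, hx, hy, rfl, rfl⟩ := hform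
      have hcase : Q = 2 ∧ 5 * x + 1 = y + 0 * 2 ^ m ∨ Q = 4 ∧ 5 * x + 2 = y + 4 * 2 ^ m := by
        interval_cases Q <;> omega
      have hgd : ∀ t r, 5 * x + t = y + r * 2 ^ m → gd m t x ∧ (5 * x + t) / 2 ^ m = r := by
        intro t r h
        constructor
        · intro k hk
          rw [h, shift_mod hk, ← low_pat hk]
          exact hlow (k + 1) (by omega) (by omega)
        · rw [h, Nat.add_mul_div_right _ _ hM, Nat.div_eq_of_lt hy, zero_add]
      refine ⟨x, ?_, rfl⟩
      simp only [Finset.mem_union, Finset.mem_filter, Finset.mem_range]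
      rcases hcase with ⟨_, h⟩ | ⟨_, h⟩
      · exact Or.inl ⟨hx, hgd _ _ h⟩
      · exact Or.inr ⟨hx, hgd _ _ h⟩
  · rw [Finset.disjoint_left]
    intro x h1 h2
    simp only [Finset.mem_filter] at h1 h2
    have g1 := h1.2.2
    have g2 := h2.2.2
    rw [Nat.div_eq_iff hM] at g1 g2
    omega

lemma numCar_pow_mul (d i a : ℕ) : numCar d (2 ^ i * a) = numCar d a := by
  induction i with
  | zero => simp
  | succ i ih =>
    have : 2 ^ (i + 1) * a = 2 * (2 ^ i * a) := by ring
    rw [this, numCar_two_mul, ih]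

lemma count_all {d : ℕ} (hd : 2 ≤ d) :
    ((Finset.range (2 ^ d - 1)).filter (fun a => numCar d a = 1)).card =
      d * ((Finset.range (2 ^ d - 1)).filter
        (fun a => numCar d a = 1 ∧ car (2 ^ d - 1) a)).card := by
  have hn : 0 < 2 ^ d - 1 := by
    have : 2 ^ 2 ≤ 2 ^ d := Nat.pow_le_pow_right (by norm_num) hd
    omega
  have h1 : ((Finset.range (2 ^ d - 1)).filter (fun a => numCar d a = 1)).card =
      ∑ a ∈ (Finset.range (2 ^ d - 1)).filter (fun a => numCar d a = 1),
        ∑ i ∈ Finset.range d, if car (2 ^ d - 1) (2 ^ i * a) then 1 else 0 := by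
    rw [Finset.card_eq_sum_ones]
    apply Finset.sum_congr rfl
    intro a ha
    rw [← Finset.card_filter]
    exact (Finset.mem_filter.1 ha).2.symm
  rw [h1, Finset.sum_comm]
  have h2 : ∀ i ∈ Finset.range d,
      (∑ a ∈ (Finset.range (2 ^ d - 1)).filter (fun a => numCar d a = 1),
        if car (2 ^ d - 1) (2 ^ i * a) then 1 else 0) =
      ((Finset.range (2 ^ d - 1)).filter
        (fun a => numCar d a = 1 ∧ car (2 ^ d - 1) a)).card := by
    intro i hi
    have hid : i < d := Finset.mem_range.1 hi
    rw [← Finset.card_filter, Finset.filter_filter]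
    apply Finset.card_bij (fun a _ => (2 ^ i * a) % (2 ^ d - 1))
    · intro a ha
      simp only [Finset.mem_filter, Finset.mem_range] at ha ⊢
      refine ⟨Nat.mod_lt _ hn, ?_, ?_⟩
      · rw [numCar_congr (Nat.mod_modEq _ _), numCar_pow_mul]; exact ha.2.1
      · rw [car_congr (Nat.mod_modEq _ _)]; exact ha.2.2
    · intro a ha b hb h
      simp only [Finset.mem_filter, Finset.mem_range] at ha hb
      have h' : 2 ^ i * a ≡ 2 ^ i * b [MOD (2 ^ d - 1)] := h
      have h3 := Nat.ModEq.cancel_left_of_coprime (pow_coprime (by omega) i) h'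
      exact Nat.ModEq.eq_of_lt_of_lt h3 ha.1 hb.1
    · intro b hb
      simp only [Finset.mem_filter, Finset.mem_range] at hb ⊢
      have e : 2 ^ i * (2 ^ (d - i) * b) = 2 ^ d * b := by
        rw [← mul_assoc, ← pow_add]; congr 2; omega
      have h3 : 2 ^ i * ((2 ^ (d - i) * b) % (2 ^ d - 1)) ≡ b [MOD (2 ^ d - 1)] := by
        refine ((Nat.mod_modEq _ _).mul_left _).trans ?_
        rw [e]
        exact pow_d_mod d b
      refine ⟨(2 ^ (d - i) * b) % (2 ^ d - 1), ⟨Nat.mod_lt _ hn, ?_, ?_⟩, ?_⟩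
      · rw [numCar_congr (Nat.mod_modEq _ _), numCar_pow_mul]; exact hb.2.1
      · rw [car_congr h3]; exact hb.2.2
      · rw [h3, Nat.mod_eq_of_lt hb.1]
  rw [Finset.sum_congr rfl h2, Finset.sum_const, Finset.card_range, smul_eq_mul]

lemma units_sum {F : Type*} [Field F] [Fintype F] [DecidableEq F] (I : Finset F) (f : F → F) :
    ∑ u : Fˣ, (if (u : F) ∈ I then f u else 0) = ∑ y ∈ I.erase 0, f y := by
  rw [← Finset.sum_filter]
  apply Finset.sum_bij (fun (u : Fˣ) _ => (u : F))
  · intro u hu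
    simp only [Finset.mem_filter, Finset.mem_univ, true_and] at hu
    exact Finset.mem_erase.2 ⟨u.ne_zero, hu⟩
  · intro u _ v _ h; exact Units.val_injective h
  · intro b hb
    obtain ⟨hb0, hb1⟩ := Finset.mem_erase.1 hb
    exact ⟨Units.mk0 b hb0, by simpa using hb1, rfl⟩
  · intro u _; rfl

lemma five_coprime {d : ℕ} (hodd : Odd d) : Nat.Coprime (2 ^ d - 1) 5 := by
  obtain ⟨k, rfl⟩ := hodd
  have h : 2 ^ (2 * k + 1) % 5 = 2 ∨ 2 ^ (2 * k + 1) % 5 = 3 := by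
    induction k with
    | zero => simp
    | succ k ih =>
      have : 2 ^ (2 * (k + 1) + 1) = 4 * 2 ^ (2 * k + 1) := by ring
      omega
  rw [Nat.coprime_comm, Nat.Prime.coprime_iff_not_dvd (by norm_num)]
  generalize 2 ^ (2 * k + 1) = N at h ⊢
  omega

lemma char_iff {F : Type*} [Field F] [Fintype F] [DecidableEq F] [CharP F 2]
    (d : ℕ) (hodd : Odd d) (hd : 5 ≤ d) (hcard : Fintype.card F = 2 ^ d)
    (hcu : Fintype.card Fˣ = 2 ^ d - 1)
    (h2 : ∀ y : F, (∃ x, x + x ^ 6 = y) →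
      ((Finset.univ : Finset F).filter (fun x => x + x ^ 6 = y)).card = 2) (a : ℕ) :
    (∑ u : Fˣ, (if (u : F) ∈ (Finset.univ : Finset F).image (fun x => x + x ^ 6) then 0 else 1) *
      (((u⁻¹) ^ 5 : Fˣ) : F) ^ a) ≠ 0 ↔ numCar d a = 1 := by
  set I := (Finset.univ : Finset F).image (fun x => x + x ^ 6) with hI
  set S : ℕ → F := fun a => ∑ u : Fˣ, (if (u : F) ∈ I then 0 else 1) *
      (((u⁻¹) ^ 5 : Fˣ) : F) ^ a with hS
  change S a ≠ 0 ↔ _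
  set n := 2 ^ d - 1 with hn
  have h2d : 32 ≤ 2 ^ d := by
    calc 32 = 2 ^ 5 := by norm_num
      _ ≤ 2 ^ d := Nat.pow_le_pow_right (by norm_num) hd
  have h2dvd : 2 * 2 ^ (d - 1) = 2 ^ d := by
    rw [← pow_succ']; congr 1; omega
  have hn0 : 0 < n := by omega
  have hnodd : n % 2 = 1 := by omega
  have hcop := five_coprime hodd
  rw [← hn] at hcop
  have hun : ∀ u : Fˣ, u ^ n = 1 := fun u => by rw [← hcu]; exact pow_card_eq_one
  have hpow : ∀ (u : Fˣ) {a b : ℕ}, a ≡ b [MOD n] → u ^ a = u ^ b := by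
    intro u a b h
    rw [← pow_mod_natCard u a, ← pow_mod_natCard u b, Nat.card_eq_fintype_card, hcu, h]
  have hScongr : ∀ {a b : ℕ}, a ≡ b [MOD n] → S a = S b := by
    intro a b h
    simp only [hS]
    apply Finset.sum_congr rfl
    intro u _
    rw [← Units.val_pow_eq_pow_val, ← Units.val_pow_eq_pow_val, hpow _ h]
  have hS2 : ∀ a, S (2 * a) = S a ^ 2 := by
    intro a
    simp only [hS]
    rw [sum_pow_char 2]
    apply Finset.sum_congr rfl
    intro u _
    rw [mul_pow, ← pow_mul, mul_comm 2 a]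
    split_ifs <;> simp
  have hsplit : ∀ f : F → F, ∑ u : Fˣ, (if (u : F) ∈ I then 0 else 1) * f u =
      ∑ u : Fˣ, f u - ∑ y ∈ I.erase 0, f y := by
    intro f
    rw [← units_sum, ← Finset.sum_sub_distrib]
    apply Finset.sum_congr rfl
    intro u _
    split_ifs <;> simp
  have hmain : ∀ B a, (5 * a) % n = B → (S a ≠ 0 ↔ numCar d a = 1) := by
    intro B
    induction B using Nat.strong_induction_on with
    | _ B ih =>
      intro a haB
      have hBn : B < n := by rw [← haB]; exact Nat.mod_lt _ hn0
      rcases Nat.eq_zero_or_pos B with hB0 | hB0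
      · -- trivial character
        have hdvd : n ∣ a := hcop.dvd_of_dvd_mul_left (Nat.dvd_of_mod_eq_zero (by omega))
        have ha0 : a ≡ 0 [MOD n] := (Nat.modEq_zero_iff_dvd).2 hdvd
        rw [hScongr ha0, numCar_congr (hn ▸ ha0)]
        have h3 : numCar d 0 = 0 := by
          unfold numCar car
          simp
        rw [h3]
        have h0I : (0 : F) ∈ I := by
          rw [hI, Finset.mem_image]
          exact ⟨0, Finset.mem_univ _, by simp⟩
        have hIc : 2 * I.card = 2 ^ d := by
          have h := Finset.card_eq_sum_card_image (fun x : F => x + x ^ 6) Finset.univ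
          rw [Finset.card_univ, hcard] at h
          rw [h, mul_comm, ← smul_eq_mul, ← Finset.sum_const]
          apply Finset.sum_congr rfl
          intro y hy
          rw [h2 y (by simpa [hI] using hy)]
        have h4 : S 0 = 0 := by
          have h5 := hsplit (fun _ => 1)
          have h6 : S 0 = ∑ u : Fˣ, (if (u : F) ∈ I then 0 else 1) * (fun _ => (1 : F)) (u : F) := by
            simp only [hS, pow_zero]
          rw [h6, h5]
          simp only [Finset.sum_const, Finset.card_univ, hcu, Finset.card_erase_of_mem h0I,
            nsmul_eq_mul, mul_one]
          rw [← Nat.cast_sub (by omega), CharP.cast_eq_zero_iff F 2]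
          have : 2 ^ (d - 1) = 2 * 2 ^ (d - 2) := by rw [← pow_succ']; congr 1; omega
          omega
        simp [h4]
      · rcases Nat.mod_two_eq_zero_or_one B with hBe | hBo
        · -- halve
          have hhalf : 2 * (2 ^ (d - 1) * a) ≡ a [MOD n] := by
            rw [← mul_assoc, h2dvd]
            exact pow_d_mod d a
          have hB' : (5 * (2 ^ (d - 1) * a)) % n = B / 2 := by
            have h3 : 2 * (5 * (2 ^ (d - 1) * a)) ≡ 2 * (B / 2) [MOD n] := by
              have e1 : 2 * (5 * (2 ^ (d - 1) * a)) = 5 * (2 * (2 ^ (d - 1) * a)) := by ring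
              have e2 : 2 * (B / 2) = B := by omega
              rw [e1, e2, ← haB]
              exact (hhalf.mul_left 5).trans (Nat.mod_modEq _ _).symm
            have hc2 : Nat.gcd n 2 = 1 := by
              have := pow_coprime (d := d) (by omega) 1
              simpa using this
            have h4 := Nat.ModEq.cancel_left_of_coprime hc2 h3
            rw [h4, Nat.mod_eq_of_lt (by omega)]
          have h5 := ih (B / 2) (by omega) _ hB'
          rw [← hScongr hhalf, hS2, ← numCar_congr (hn ▸ hhalf), numCar_two_mul, ← h5]
          simp
        · -- odd case
          obtain ⟨e, he⟩ : ∃ e, B + e = n := ⟨n - B, by omega⟩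
          have he0 : 0 < e := by omega
          have hSe : S a = ∑ u : Fˣ, (if (u : F) ∈ I then 0 else 1) *
              (fun y : F => y ^ e) (u : F) := by
            simp only [hS]
            apply Finset.sum_congr rfl
            intro u _
            congr 1
            rw [← Units.val_pow_eq_pow_val, ← Units.val_pow_eq_pow_val]
            congr 1
            rw [← pow_mul, inv_pow, inv_eq_iff_mul_eq_one, ← pow_add]
            have h3 : 5 * a + e ≡ 0 [MOD n] := by
              have h4 : 5 * a + e ≡ B + e [MOD n] := by
                rw [← haB]
                exact (Nat.mod_modEq _ _).symm.add_right _
              rw [he] at h4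
              exact h4.trans (by simp [Nat.ModEq])
            rw [hpow u h3, pow_zero]
          have hz : ∑ u : Fˣ, (fun y : F => y ^ e) (u : F) = 0 := by
            have h3 := FiniteField.sum_pow_units F e
            have h4 : ¬ (Fintype.card F - 1 ∣ e) := by
              rw [hcard, ← hn]
              intro h
              have := Nat.le_of_dvd he0 h
              omega
            rw [if_neg h4] at h3
            simpa using h3
          have hSe2 := hSe.trans (hsplit (fun y : F => y ^ e))
          beta_reduce at hSe2 hz
          rw [hSe2, hz, zero_sub, neg_ne_zero]
          have her : ∑ y ∈ I.erase 0, y ^ e = ∑ y ∈ I, y ^ e := by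
            apply Finset.sum_erase
            simp [he0.ne']
          have hamod : a ≡ a % n [MOD n] := (Nat.mod_modEq _ _).symm
          have haB' : 5 * (a % n) % n = B := by
            rw [Nat.mul_mod_mod, haB]
          rw [her, numCar_congr (hn ▸ hamod),
            ← choose_iff (e := e) (by omega) (Nat.mod_lt _ hn0) he0 (by rw [← hn, haB']; exact he)
              (by omega) (by omega)]
          apply image_sum h2 n hcu hnodd e (a % n) he0 (by omega) (by omega)
          intro j hj
          constructor
          · intro h
            have h3 : 5 * j + e ≡ 5 * a + e [MOD n] := by
              have h4 : 5 * a + e ≡ B + e [MOD n] := by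
                rw [← haB]
                exact (Nat.mod_modEq _ _).symm.add_right _
              rw [he] at h4
              have h5 : 5 * j + e ≡ 0 [MOD n] := by
                rw [Nat.modEq_zero_iff_dvd, add_comm]; exact h
              exact h5.trans ((h4.trans (by simp [Nat.ModEq])).symm)
            have h4 := Nat.ModEq.cancel_left_of_coprime hcop (Nat.ModEq.add_right_cancel' e h3)
            rw [← h4, Nat.mod_eq_of_lt (by omega)]
          · intro h
            have h6 := Nat.div_add_mod (5 * j) n
            rw [h, haB'] at h6
            rw [h]
            refine ⟨5 * (a % n) / n + 1, ?_⟩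
            rw [mul_add, mul_one]
            omega
  exact hmain _ a rfl

end Segre

open scoped Classical in
/-- For odd `d ≥ 5`, with `τ(x) = x + x^6` two-to-one on `F_{2^d}` (the Segre hyperoval
case), the 2-rank of the complement of `D_{6,d} = τ(F_{2^d}) \ {0}` in `F_{2^d}ˣ` equals
`d (2 F_{(d-1)/2} - 1)`. -/
theorem stmt_8 (d : ℕ) (hodd : Odd d) (hd : 5 ≤ d)
    (h2to1 : ∀ y : GaloisField 2 d, (∃ x, x + x ^ 6 = y) →
      Nat.card {x : GaloisField 2 d // x + x ^ 6 = y} = 2) :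
    matRank (ZMod 2)
      (Matrix.of fun u v : (GaloisField 2 d)ˣ =>
        if (v * u⁻¹ : (GaloisField 2 d)ˣ) ∈
            ({u : (GaloisField 2 d)ˣ |
                ∃ x : GaloisField 2 d, x + x ^ 6 = (u : GaloisField 2 d)}ᶜ) then
          (1 : ZMod 2) else 0) =
      d * (2 * Fib' ((d - 1) / 2) - 1) := by
  classical
  have : Fact (Nat.Prime 2) := ⟨Nat.prime_two⟩
  letI : Fintype (GaloisField 2 d) := Fintype.ofFinite _
  have hcard : Fintype.card (GaloisField 2 d) = 2 ^ d := by
    rw [← Nat.card_eq_fintype_card, GaloisField.card 2 d (by omega)]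
  have hcu : Fintype.card (GaloisField 2 d)ˣ = 2 ^ d - 1 := by
    rw [Fintype.card_units, hcard]
  have h2 : ∀ y : GaloisField 2 d, (∃ x, x + x ^ 6 = y) →
      ((Finset.univ : Finset (GaloisField 2 d)).filter (fun x => x + x ^ 6 = y)).card = 2 := by
    intro y hy
    have h3 := h2to1 y hy
    rw [Nat.card_eq_fintype_card, Fintype.card_subtype] at h3
    convert h3
  have hinj : Function.Injective (fun u : (GaloisField 2 d)ˣ => u ^ 5) := by
    have hc : (Nat.card (GaloisField 2 d)ˣ).Coprime 5 := by
      rw [Nat.card_eq_fintype_card, hcu]; exact Segre.five_coprime hodd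
    exact (powCoprime hc).injective
  have hM : ∀ M : Matrix (GaloisField 2 d)ˣ (GaloisField 2 d)ˣ (ZMod 2),
      matRank (ZMod 2) M = (M.map (algebraMap (ZMod 2) (GaloisField 2 d))).rank := by
    intro M
    rw [Segre.rank_map_field]
    unfold matRank
    congr!
  rw [hM]
  refine (congrArg Matrix.rank (?_ : _ = (Matrix.of fun u v : (GaloisField 2 d)ˣ =>
        (fun y : (GaloisField 2 d)ˣ => if (y : GaloisField 2 d) ∈
          (Finset.univ : Finset (GaloisField 2 d)).image (fun x => x + x ^ 6) then
          (0 : GaloisField 2 d) else 1) (v * u⁻¹)))).trans ?_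
  · ext u v
    simp only [Matrix.map_apply, Matrix.of_apply, Set.mem_compl_iff, Set.mem_ofPred_eq,
      Finset.mem_image, Finset.mem_univ, true_and]
    by_cases h : ∃ x : GaloisField 2 d, x + x ^ 6 = ((v * u⁻¹ : (GaloisField 2 d)ˣ) : GaloisField 2 d)
    · rw [if_neg (not_not.2 h), if_pos h, map_zero]
    · rw [if_pos h, if_neg h, map_one]
  refine (Segre.rank_circ (fun y : (GaloisField 2 d)ˣ => if (y : GaloisField 2 d) ∈
          (Finset.univ : Finset (GaloisField 2 d)).image (fun x => x + x ^ 6) then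
          (0 : GaloisField 2 d) else 1) hinj).trans ?_
  rw [hcu]
  have hchar := Segre.char_iff d hodd hd hcard hcu h2
  rw [Finset.filter_congr (fun a _ => hchar a), Segre.count_all (by omega)]
  obtain ⟨k, hk⟩ := hodd
  obtain ⟨k, rfl⟩ : ∃ k', k = k' + 1 := ⟨k - 1, by omega⟩
  rw [Segre.count_norm (m := 2 * k + 1) (by omega), Segre.cnt_total]
  have : (d - 1) / 2 = k + 1 := by omega
  rw [this, Fib']
end
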